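/- arXiv:2306.09040 — 2 statements merged into one kernel-verified Lean document; each statement's English description precedes it below -/
import Mathlib

section
/- There exists a universal constant C > 0 such that for every ε with 0 < ε ≤ 1 there exists n₀ = n₀(ε) such that for all n ≥ n₀: if δ : Fin n × {a,b} → Fin n is a uniformly random transition function, then with probability at least 1 − ε there exists a synchronizing word for δ of length at most C·ε⁻¹·√(n·ln n). -/
open scoped BigOperators Classical

/-- `run δ ω x` applies the transitions of the word `ω` (over the two-letter
alphabet `Bool`, with `false = 'a'` and `true = 'b'`) starting from state `x`,
i.e. `run δ ω = δ_ω = δ_{ω_k} ∘ ⋯ ∘ δ_{ω_1}`. -/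
def run {n : ℕ} (δ : Fin n × Bool → Fin n) : List Bool → Fin n → Fin n
  | [], x => x
  | c :: w, x => run δ w (δ (x, c))

namespace RandomAutomaton

section

/-- The real-valued indicator of a proposition. -/
noncomputable def ind (p : Prop) : ℝ := if p then 1 else 0

lemma ind_nonneg (p : Prop) : 0 ≤ ind p := by unfold ind; split_ifs <;> norm_num

lemma ind_le_one (p : Prop) : ind p ≤ 1 := by unfold ind; split_ifs <;> norm_num

lemma ind_of_true {p : Prop} (h : p) : ind p = 1 := by simp [ind, h]

lemma ind_of_not {p : Prop} (h : ¬p) : ind p = 0 := by simp [ind, h]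

lemma ind_mono {p q : Prop} (h : p → q) : ind p ≤ ind q := by
  by_cases hp : p
  · rw [ind_of_true hp, ind_of_true (h hp)]
  · rw [ind_of_not hp]; exact ind_nonneg q

lemma ind_congr {p q : Prop} (h : p ↔ q) : ind p = ind q := by
  rw [propext h]

lemma ind_and (p q : Prop) : ind (p ∧ q) = ind p * ind q := by
  by_cases hp : p <;> by_cases hq : q <;> simp [ind, hp, hq]

lemma ind_or_le (p q : Prop) : ind (p ∨ q) ≤ ind p + ind q := by
  by_cases hp : p <;> by_cases hq : q <;> simp [ind, hp, hq]

lemma ind_not (p : Prop) : ind (¬p) = 1 - ind p := by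
  by_cases hp : p <;> simp [ind, hp]

lemma ind_exists_mem_le {α : Type*} (s : Finset α) (P : α → Prop) :
    ind (∃ a ∈ s, P a) ≤ ∑ a ∈ s, ind (P a) := by
  by_cases h : ∃ a ∈ s, P a
  · obtain ⟨a, ha, hP⟩ := h
    calc ind (∃ a ∈ s, P a) ≤ 1 := ind_le_one _
      _ = ind (P a) := (ind_of_true hP).symm
      _ ≤ _ := Finset.single_le_sum (f := fun a => ind (P a)) (fun b _ => ind_nonneg _) ha
  · rw [ind_of_not h]; exact Finset.sum_nonneg fun b _ => ind_nonneg _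

lemma ind_exists_le {α : Type*} [Fintype α] (P : α → Prop) :
    ind (∃ a, P a) ≤ ∑ a, ind (P a) := by
  simpa using ind_exists_mem_le Finset.univ P

lemma sum_ind {α : Type*} [Fintype α] (P : α → Prop) [DecidablePred P] :
    ∑ a, ind (P a) = ((Finset.univ.filter P).card : ℝ) := by
  rw [Finset.card_filter, Nat.cast_sum]
  refine Finset.sum_congr rfl fun a _ => ?_
  by_cases h : P a <;> simp [ind, h]

lemma sum_ind_mul_of_eq {α : Type*} [Fintype α] (a : α) (φ : α → ℝ) :
    ∑ b, ind (a = b) * φ b = φ a := by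
  simp [ind]

/-- Uniform average over a finite type. -/
noncomputable def av {Ω : Type*} [Fintype Ω] (F : Ω → ℝ) : ℝ :=
  (∑ ω, F ω) / Fintype.card Ω

section av

variable {Ω Ω' : Type*} [Fintype Ω] [Fintype Ω']

lemma av_mono {F G : Ω → ℝ} (h : ∀ ω, F ω ≤ G ω) : av F ≤ av G := by
  unfold av
  gcongr with ω
  exact h ω

lemma av_nonneg {F : Ω → ℝ} (h : ∀ ω, 0 ≤ F ω) : 0 ≤ av F :=
  div_nonneg (Finset.sum_nonneg fun ω _ => h ω) (Nat.cast_nonneg _)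

lemma av_add (F G : Ω → ℝ) : av (fun ω => F ω + G ω) = av F + av G := by
  simp [av, Finset.sum_add_distrib, add_div]

lemma av_sub (F G : Ω → ℝ) : av (fun ω => F ω - G ω) = av F - av G := by
  simp [av, Finset.sum_sub_distrib, sub_div]

lemma av_const_mul (c : ℝ) (F : Ω → ℝ) : av (fun ω => c * F ω) = c * av F := by
  simp [av, ← Finset.mul_sum, mul_div_assoc]

lemma av_mul_const (F : Ω → ℝ) (c : ℝ) : av (fun ω => F ω * c) = av F * c := by
  simp_rw [mul_comm _ c]; exact av_const_mul c F

lemma av_const [Nonempty Ω] (c : ℝ) : av (fun _ : Ω => c) = c := by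
  simp [av]

lemma av_const_le {c : ℝ} (hc : 0 ≤ c) : av (fun _ : Ω => c) ≤ c := by
  rcases isEmpty_or_nonempty Ω with h | h
  · simpa [av] using hc
  · exact (av_const c).le

lemma av_le_of_le {F : Ω → ℝ} {c : ℝ} (hc : 0 ≤ c) (h : ∀ ω, F ω ≤ c) : av F ≤ c :=
  (av_mono h).trans (av_const_le hc)

lemma av_sum {ι : Type*} (s : Finset ι) (F : ι → Ω → ℝ) :
    av (fun ω => ∑ i ∈ s, F i ω) = ∑ i ∈ s, av (F i) := by
  simp only [av]
  rw [Finset.sum_comm, Finset.sum_div]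

lemma av_comm (F : Ω → Ω' → ℝ) :
    av (fun ω => av (fun ω' => F ω ω')) = av (fun ω' => av (fun ω => F ω ω')) := by
  simp only [av, ← Finset.sum_div]
  rw [Finset.sum_comm]
  ring

lemma av_prod (F : Ω × Ω' → ℝ) :
    av F = av (fun ω => av (fun ω' => F (ω, ω'))) := by
  simp only [av, ← Finset.sum_div, Fintype.sum_prod_type, Fintype.card_prod, Nat.cast_mul]
  rw [div_div, mul_comm (Fintype.card Ω : ℝ)]

lemma av_equiv (e : Ω ≃ Ω') (F : Ω' → ℝ) : av (fun ω => F (e ω)) = av F := by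
  simp only [av, e.sum_comp, Fintype.card_congr e]

lemma av_sq_le (F : Ω → ℝ) : (av F) ^ 2 ≤ av (fun ω => F ω ^ 2) := by
  rcases isEmpty_or_nonempty Ω with h | h
  · simp [av]
  have hc : (0 : ℝ) < Fintype.card Ω := by exact_mod_cast Fintype.card_pos
  unfold av
  rw [div_pow, div_le_div_iff₀ (by positivity) hc]
  have := sq_sum_le_card_mul_sum_sq (s := (Finset.univ : Finset Ω)) (f := F)
  rw [Finset.card_univ] at this
  nlinarith

lemma av_ind_lt_le {F : Ω → ℝ} (hF : ∀ ω, 0 ≤ F ω) {c : ℝ} (hc : 0 < c) :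
    av (fun ω => ind (c < F ω)) ≤ av F / c := by
  rw [div_eq_mul_inv, ← av_mul_const]
  refine av_mono fun ω => ?_
  by_cases h : c < F ω
  · rw [ind_of_true h, ← div_eq_mul_inv, le_div_iff₀ hc]; linarith
  · rw [ind_of_not h]
    have := hF ω
    positivity

lemma av_ind_eq (P : Ω → Prop) [DecidablePred P] :
    av (fun ω => ind (P ω)) = ((Finset.univ.filter P).card : ℝ) / Fintype.card Ω := by
  rw [av, sum_ind]

end av

/-- Resampling one coordinate of a uniformly random function does not change averages. -/
lemma av_update {X Y : Type*} [Fintype X] [Fintype Y] (z : X) (H : (X → Y) → ℝ) :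
    av H = av (fun g : X → Y => av (fun y : Y => H (Function.update g z y))) := by
  rcases isEmpty_or_nonempty Y with h | h
  · have : IsEmpty (X → Y) := ⟨fun g => h.false (g z)⟩
    simp [av]
  let e : (X → Y) × Y ≃ (X → Y) × Y :=
    { toFun := fun p => (Function.update p.1 z p.2, p.1 z)
      invFun := fun p => (Function.update p.1 z p.2, p.1 z)
      left_inv := fun p => by simp
      right_inv := fun p => by simp }
  have h1 := av_equiv e (fun p => H p.1)
  rw [av_prod, av_prod] at h1
  simp only [e, Equiv.coe_fn_mk] at h1
  rw [h1]
  congr 1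
  funext g
  exact (av_const _).symm

end

section

/-- A random self-map of `X` with independent values distributed according to `p`, expressed
through invariance under resampling of single values. -/
structure IsRandomMap {Ω X : Type*} [Fintype Ω] [Fintype X] (h : Ω → X → X) (p : X → ℝ) :
    Prop where
  nonneg : ∀ x, 0 ≤ p x
  sum_eq_one : ∑ x, p x = 1
  resample : ∀ (z : X) (Φ : (X → X) → ℝ),
    av (fun ω => Φ (h ω)) = av (fun ω => ∑ x, p x * Φ (Function.update (h ω) z x))

/-- `z` is reached from some point after exactly `k` steps, and not before. -/
def Reached {X : Type*} (k : ℕ) (φ : X → X) (z : X) : Prop :=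
  ∃ u, φ^[k] u = z ∧ ∀ i < k, φ^[i] u ≠ z

/-- `z` is reached after exactly `k` steps by a path avoiding `z` and `z'` before. -/
def ReachedAvoiding {X : Type*} (k : ℕ) (φ : X → X) (z z' : X) : Prop :=
  ∃ u, φ^[k] u = z ∧ ∀ i < k, φ^[i] u ≠ z ∧ φ^[i] u ≠ z'

/-- The pair `z, z'` is reached after `k` steps by paths avoiding both points before. -/
def PairReached {X : Type*} (k : ℕ) (φ : X → X) (z z' : X) : Prop :=
  ReachedAvoiding k φ z z' ∧ ReachedAvoiding k φ z' z

/-- The number of points reached after exactly `k` steps for the first time. -/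
noncomputable def reachedCount {X : Type*} [Fintype X] (k : ℕ) (φ : X → X) : ℝ :=
  ∑ z, ind (Reached k φ z)

section deterministic

variable {X : Type*}

lemma iterate_eq_of_eqOn_path {φ ψ : X → X} {u : X} {k : ℕ}
    (h : ∀ i < k, φ (φ^[i] u) = ψ (φ^[i] u)) : ∀ i ≤ k, ψ^[i] u = φ^[i] u := by
  intro i
  induction i with
  | zero => intro _; rfl
  | succ i ih =>
    intro hi
    rw [Function.iterate_succ_apply', Function.iterate_succ_apply', ih (by omega),
      h i (by omega)]

lemma ReachedAvoiding.congr {φ ψ : X → X} {k : ℕ} {z z' : X}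
    (hφ : ∀ x, x ≠ z → x ≠ z' → φ x = ψ x) (h : ReachedAvoiding k φ z z') :
    ReachedAvoiding k ψ z z' := by
  obtain ⟨u, hu, ha⟩ := h
  have := iterate_eq_of_eqOn_path (φ := φ) (ψ := ψ) (u := u) (k := k)
    fun i hi => hφ _ (ha i hi).1 (ha i hi).2
  refine ⟨u, by rw [this k le_rfl, hu], fun i hi => ?_⟩
  rw [this i hi.le]
  exact ha i hi

lemma PairReached.congr {φ ψ : X → X} {k : ℕ} {z z' : X}
    (hφ : ∀ x, x ≠ z → x ≠ z' → φ x = ψ x) (h : PairReached k φ z z') :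
    PairReached k ψ z z' :=
  ⟨h.1.congr hφ, h.2.congr fun x h1 h2 => hφ x h2 h1⟩

lemma pairReached_update_left (k : ℕ) (φ : X → X) (z z' x : X) :
    PairReached k (Function.update φ z x) z z' ↔ PairReached k φ z z' :=
  ⟨fun h => h.congr fun y h1 _ => by simp [h1], fun h => h.congr fun y h1 _ => by simp [h1]⟩

lemma pairReached_update_right (k : ℕ) (φ : X → X) (z z' x : X) :
    PairReached k (Function.update φ z' x) z z' ↔ PairReached k φ z z' :=
  ⟨fun h => h.congr fun y _ h1 => by simp [h1], fun h => h.congr fun y _ h1 => by simp [h1]⟩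

lemma ReachedAvoiding.reached {φ : X → X} {k : ℕ} {z z' : X} (h : ReachedAvoiding k φ z z') :
    Reached k φ z := by
  obtain ⟨u, hu, ha⟩ := h
  exact ⟨u, hu, fun i hi => (ha i hi).1⟩

lemma Reached.avoiding_or {φ : X → X} {k : ℕ} {z : X} (h : Reached k φ z) (z' : X) :
    ReachedAvoiding k φ z z' ∨ ∃ j ∈ Finset.Icc 1 k, φ^[j] z' = z := by
  obtain ⟨u, hu, ha⟩ := h
  by_cases hz : ∀ i < k, φ^[i] u ≠ z'
  · exact Or.inl ⟨u, hu, fun i hi => ⟨ha i hi, hz i hi⟩⟩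
  · push Not at hz
    obtain ⟨i, hi, rfl⟩ := hz
    refine Or.inr ⟨k - i, by simp; omega, ?_⟩
    rw [← Function.iterate_add_apply, Nat.sub_add_cancel hi.le, hu]

lemma Reached.exists_pred {φ : X → X} {k : ℕ} {y : X} (h : Reached (k + 1) φ y) :
    ∃ z, Reached k φ z ∧ φ z = y := by
  obtain ⟨u, hu, ha⟩ := h
  refine ⟨φ^[k] u, ⟨u, rfl, fun i hi he => ?_⟩, by rw [← Function.iterate_succ_apply' φ, hu]⟩
  refine ha (i + 1) (by omega) ?_
  rw [Function.iterate_succ_apply', he, ← Function.iterate_succ_apply' φ, hu]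

variable [Fintype X]

/-- Few pairs of reached points fail to be jointly reached. -/
lemma sq_reachedCount_le (k : ℕ) (φ : X → X) :
    reachedCount k φ ^ 2 - (2 * k + 1) * reachedCount k φ ≤
      ∑ q ∈ (Finset.univ : Finset X).offDiag, ind (PairReached k φ q.1 q.2) := by
  have key : ∀ z z' : X, ind (Reached k φ z) * ind (Reached k φ z') ≤
      (if z ≠ z' then ind (PairReached k φ z z') else 0) +
      ind (z = z') * ind (Reached k φ z) +
      ind (Reached k φ z') * ∑ j ∈ Finset.Icc 1 k, ind (φ^[j] z' = z) +
      ind (Reached k φ z) * ∑ j ∈ Finset.Icc 1 k, ind (φ^[j] z = z') := by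
    intro z z'
    have n1 : 0 ≤ ∑ j ∈ Finset.Icc 1 k, ind (φ^[j] z' = z) :=
      Finset.sum_nonneg fun _ _ => ind_nonneg _
    have n2 : 0 ≤ ∑ j ∈ Finset.Icc 1 k, ind (φ^[j] z = z') :=
      Finset.sum_nonneg fun _ _ => ind_nonneg _
    have n3 : 0 ≤ ind (PairReached k φ z z') := ind_nonneg _
    by_cases h1 : Reached k φ z
    swap
    · rw [ind_of_not h1]
      have := ind_nonneg (Reached k φ z')
      split_ifs <;> nlinarith [mul_nonneg this n1]
    by_cases h2 : Reached k φ z'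
    swap
    · rw [ind_of_not h2]
      have := ind_nonneg (Reached k φ z)
      have h4 := ind_nonneg (z = z')
      split_ifs <;> nlinarith [mul_nonneg this n2, mul_nonneg h4 this]
    rw [ind_of_true h1, ind_of_true h2]
    by_cases hz : z = z'
    · rw [ind_of_true hz]; simp [hz] at *; linarith
    rw [ind_of_not hz, if_pos hz]
    rcases h1.avoiding_or z' with a | a
    · rcases h2.avoiding_or z with b | b
      · rw [ind_of_true (p := PairReached k φ z z') ⟨a, b⟩]; linarith
      · have := ind_exists_mem_le (Finset.Icc 1 k) (fun j => φ^[j] z = z')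
        rw [ind_of_true b] at this
        linarith
    · have := ind_exists_mem_le (Finset.Icc 1 k) (fun j => φ^[j] z' = z)
      rw [ind_of_true a] at this
      linarith
  have hsum := Finset.sum_le_sum (s := (Finset.univ : Finset X)) fun z _ =>
    Finset.sum_le_sum (s := (Finset.univ : Finset X)) fun z' _ => key z z'
  simp only [Finset.sum_add_distrib] at hsum
  have e0 : ∑ z, ∑ z', ind (Reached k φ z) * ind (Reached k φ z') = reachedCount k φ ^ 2 := by
    rw [sq, reachedCount, Finset.sum_mul_sum]
  have e1 : ∑ z, ∑ z', (if z ≠ z' then ind (PairReached k φ z z') else 0) =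
      ∑ q ∈ (Finset.univ : Finset X).offDiag, ind (PairReached k φ q.1 q.2) := by
    rw [← Finset.sum_product', ← Finset.sum_filter]
    congr 1
    ext q; simp
  have e2 : ∑ z, ∑ z', ind (z = z') * ind (Reached k φ z) = reachedCount k φ := by
    rw [reachedCount]
    exact Finset.sum_congr rfl fun z _ => sum_ind_mul_of_eq z fun _ => ind (Reached k φ z)
  have e4 : ∑ z, ∑ z', ind (Reached k φ z) * ∑ j ∈ Finset.Icc 1 k, ind (φ^[j] z = z') =
      k * reachedCount k φ := by
    rw [reachedCount, Finset.mul_sum]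
    refine Finset.sum_congr rfl fun z _ => ?_
    rw [← Finset.mul_sum, Finset.sum_comm]
    have : ∀ j ∈ Finset.Icc 1 k, ∑ z', ind (φ^[j] z = z') = 1 := fun j _ => by simp [ind]
    rw [Finset.sum_congr rfl this]
    simp [mul_comm]
  have e3 : ∑ z, ∑ z', ind (Reached k φ z') * ∑ j ∈ Finset.Icc 1 k, ind (φ^[j] z' = z) =
      k * reachedCount k φ := by
    rw [Finset.sum_comm, e4]
  rw [e0, e1, e2, e3, e4] at hsum
  linarith

/-- Per-fibre lower bound on the number of points lost by merging. -/
lemma ind_le_sub_of_fibre (k : ℕ) (φ : X → X) (y : X) {m : ℝ} (hm : 1 ≤ m) :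
    ind (∃ z, Reached k φ z ∧ φ z = y) ≤ (∑ z, ind (Reached k φ z ∧ φ z = y)) -
      (1 / (4 * m)) * (∑ q ∈ (Finset.univ : Finset X).offDiag,
        ind (PairReached k φ q.1 q.2) * ind (φ q.1 = y) * ind (φ q.2 = y)) +
      (1 / (12 * m ^ 2)) * (∑ q ∈ (Finset.univ : Finset X).offDiag,
        (ind (PairReached k φ q.1 q.2) * ∑ x ∈ Finset.univ \ {q.1, q.2}, ind (φ x = y)) *
          ind (φ q.1 = y) * ind (φ q.2 = y)) := by
  set N : ℝ := ∑ z, ind (Reached k φ z ∧ φ z = y) with hN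
  set D : ℝ := ∑ z, ind (φ z = y) with hD
  set e : ℝ := ∑ q ∈ (Finset.univ : Finset X).offDiag,
        ind (PairReached k φ q.1 q.2) * ind (φ q.1 = y) * ind (φ q.2 = y) with he
  have htri : ∑ q ∈ (Finset.univ : Finset X).offDiag,
        (ind (PairReached k φ q.1 q.2) * ∑ x ∈ Finset.univ \ {q.1, q.2}, ind (φ x = y)) *
          ind (φ q.1 = y) * ind (φ q.2 = y) = e * (D - 2) := by
    rw [he, Finset.sum_mul]
    refine Finset.sum_congr rfl fun q hq => ?_
    by_cases h1 : φ q.1 = y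
    swap
    · simp [ind_of_not h1]
    by_cases h2 : φ q.2 = y
    swap
    · simp [ind_of_not h2]
    have hne : q.1 ≠ q.2 := by simpa using hq
    have : ∑ x ∈ Finset.univ \ {q.1, q.2}, ind (φ x = y) = D - 2 := by
      rw [hD, ← Finset.sum_sdiff (Finset.subset_univ {q.1, q.2}), Finset.sum_pair hne,
        ind_of_true h1, ind_of_true h2]
      ring
    rw [this, ind_of_true h1, ind_of_true h2]
    ring
  rw [htri]
  have hNcard : N = ((Finset.univ.filter fun z => Reached k φ z ∧ φ z = y).card : ℝ) := sum_ind _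
  set S := Finset.univ.filter fun z => Reached k φ z ∧ φ z = y with hS
  have he0 : 0 ≤ e := Finset.sum_nonneg fun q _ =>
    mul_nonneg (mul_nonneg (ind_nonneg _) (ind_nonneg _)) (ind_nonneg _)
  have heN : e ≤ N * (N - 1) := by
    have : e ≤ (S.offDiag.card : ℝ) := by
      have hsub : S.offDiag ⊆ (Finset.univ : Finset X).offDiag :=
        Finset.offDiag_mono (Finset.subset_univ _)
      rw [he, Finset.card_eq_sum_ones, Nat.cast_sum, ← Finset.sum_subset hsub]
      · refine Finset.sum_le_sum fun q _ => ?_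
        rw [← ind_and, ← ind_and]
        simpa using ind_le_one _
      · intro q hq hqS
        rw [← ind_and, ← ind_and]
        refine ind_of_not fun ⟨⟨⟨h1, h2⟩, h3⟩, h4⟩ => hqS ?_
        have hne : q.1 ≠ q.2 := by simpa using hq
        simp [hS, h1.reached, h2.reached, h3, h4, hne]
    refine this.trans (le_of_eq ?_)
    rw [Finset.offDiag_card, Nat.cast_sub (Nat.le_mul_self _), hNcard]
    push_cast
    ring
  have hND : N ≤ D := Finset.sum_le_sum fun z _ => ind_mono fun h => h.2
  have hmain : e * (1 / (4 * m)) * (1 - (D - 2) / (3 * m)) ≤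
      N - ind (∃ z, Reached k φ z ∧ φ z = y) := by
    by_cases hex : ∃ z, Reached k φ z ∧ φ z = y
    · rw [ind_of_true hex]
      have hN1 : 1 ≤ N := by
        rw [hNcard]
        obtain ⟨z, hz⟩ := hex
        exact_mod_cast Finset.card_pos.mpr ⟨z, by simpa [hS] using hz⟩
      have hm0 : (0 : ℝ) < m := by linarith
      by_cases hb : 1 - (D - 2) / (3 * m) ≤ 0
      · have := mul_nonneg he0 (by positivity : 0 ≤ 1 / (4 * m))
        nlinarith
      · push Not at hb
        have h1 : 1 - (D - 2) / (3 * m) ≤ 1 - (N - 2) / (3 * m) := by gcongr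
        calc e * (1 / (4 * m)) * (1 - (D - 2) / (3 * m))
            ≤ N * (N - 1) * (1 / (4 * m)) * (1 - (N - 2) / (3 * m)) := by gcongr
          _ = (N - 1) * (N * (3 * m + 2 - N) / (12 * m ^ 2)) := by field_simp; ring
          _ ≤ (N - 1) * 1 := by
            refine mul_le_mul_of_nonneg_left ?_ (by linarith)
            rw [div_le_one (by positivity)]
            nlinarith [sq_nonneg (3 * m + 2 - 2 * N)]
          _ = N - 1 := mul_one _
    · rw [ind_of_not hex]
      have hN0 : N = 0 := Finset.sum_eq_zero fun z _ => ind_of_not fun h => hex ⟨z, h⟩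
      have : e = 0 := le_antisymm (by rw [hN0] at heN; simpa using heN) he0
      rw [this, hN0]
      simp
  have : e * (1 / (4 * m)) * (1 - (D - 2) / (3 * m)) =
      1 / (4 * m) * e - 1 / (12 * m ^ 2) * (e * (D - 2)) := by
    have : m ≠ 0 := by linarith
    field_simp
    ring
  linarith

lemma reachedCount_succ_le (k : ℕ) (φ : X → X) {m : X → ℝ} (hm : ∀ y, 1 ≤ m y) :
    reachedCount (k + 1) φ ≤ reachedCount k φ -
      (∑ y, (1 / (4 * m y)) * (∑ q ∈ (Finset.univ : Finset X).offDiag,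
        ind (PairReached k φ q.1 q.2) * ind (φ q.1 = y) * ind (φ q.2 = y))) +
      ∑ y, (1 / (12 * m y ^ 2)) * (∑ q ∈ (Finset.univ : Finset X).offDiag,
        (ind (PairReached k φ q.1 q.2) * ∑ x ∈ Finset.univ \ {q.1, q.2}, ind (φ x = y)) *
          ind (φ q.1 = y) * ind (φ q.2 = y)) := by
  have h1 : reachedCount k φ = ∑ y, ∑ z, ind (Reached k φ z ∧ φ z = y) := by
    rw [Finset.sum_comm, reachedCount]
    refine Finset.sum_congr rfl fun z _ => ?_
    simp_rw [ind_and, mul_comm (ind (Reached k φ z))]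
    exact (sum_ind_mul_of_eq (φ z) fun _ => ind (Reached k φ z)).symm
  rw [h1, ← Finset.sum_sub_distrib, ← Finset.sum_add_distrib]
  refine Finset.sum_le_sum fun y _ => ?_
  exact (ind_mono fun h => h.exists_pred).trans (ind_le_sub_of_fibre k φ y (hm y))

lemma reachedCount_succ_le_self (k : ℕ) (φ : X → X) :
    reachedCount (k + 1) φ ≤ reachedCount k φ := by
  have h1 : reachedCount k φ = ∑ y, ∑ z, ind (Reached k φ z ∧ φ z = y) := by
    rw [Finset.sum_comm, reachedCount]
    refine Finset.sum_congr rfl fun z _ => ?_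
    simp_rw [ind_and, mul_comm (ind (Reached k φ z))]
    exact (sum_ind_mul_of_eq (φ z) fun _ => ind (Reached k φ z)).symm
  rw [h1]
  exact Finset.sum_le_sum fun y _ => (ind_mono fun h => h.exists_pred).trans (ind_exists_le _)

end deterministic

end

section

namespace IsRandomMap

variable {Ω X : Type*} [Fintype Ω] [Fintype X] {h : Ω → X → X} {p : X → ℝ}

lemma av_apply (hh : IsRandomMap h p) (z : X) (H : (X → X) → X → ℝ)
    (hH : ∀ φ x y, H (Function.update φ z x) y = H φ y) :
    av (fun ω => H (h ω) (h ω z)) = av (fun ω => ∑ x, p x * H (h ω) x) := by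
  rw [hh.resample z fun φ => H φ (φ z)]
  simp [hH]

lemma av_pair (hh : IsRandomMap h p) {z z' : X} (hz : z ≠ z') (y : X) (B : (X → X) → ℝ)
    (hB : ∀ φ x, B (Function.update φ z x) = B φ)
    (hB' : ∀ φ x, B (Function.update φ z' x) = B φ) :
    av (fun ω => B (h ω) * ind (h ω z = y) * ind (h ω z' = y)) =
      p y ^ 2 * av (fun ω => B (h ω)) := by
  rw [hh.av_apply z' (fun φ x => B φ * ind (φ z = y) * ind (x = y))
    (fun φ x y' => by simp [hB', Function.update_of_ne hz])]
  have e1 : ∀ c : ℝ, ∑ x, p x * (c * ind (x = y)) = p y * c := fun c => by simp [ind]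
  simp_rw [e1]
  rw [av_const_mul, hh.av_apply z (fun φ x => B φ * ind (x = y)) (fun φ x y' => by simp [hB])]
  simp_rw [e1]
  rw [av_const_mul]
  ring

lemma sum_collision_weights [Nonempty X] (hh : IsRandomMap h p) :
    1 / (8 * (Fintype.card X : ℝ)) ≤
      ∑ y, 1 / (4 * (1 + Fintype.card X * p y)) * p y ^ 2 := by
  have hN : (0 : ℝ) < Fintype.card X := by exact_mod_cast Fintype.card_pos
  set N : ℝ := (Fintype.card X : ℝ) with hNdef
  have key : ∀ y, (1 / (4 * N ^ 2)) * (1 / 2 + 3 / 4 * (N * p y - 1)) ≤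
      1 / (4 * (1 + N * p y)) * p y ^ 2 := by
    intro y
    have h0 := hh.nonneg y
    have h1 : 0 < 1 + N * p y := by positivity
    rw [show 1 / (4 * (1 + N * p y)) * p y ^ 2 =
      (1 / (4 * N ^ 2)) * ((N * p y) ^ 2 / (1 + N * p y)) by field_simp]
    refine mul_le_mul_of_nonneg_left ?_ (by positivity)
    rw [le_div_iff₀ h1]
    nlinarith [sq_nonneg (N * p y - 1)]
  refine le_trans (le_of_eq ?_) (Finset.sum_le_sum fun y _ => key y)
  rw [← Finset.mul_sum, Finset.sum_add_distrib, ← Finset.mul_sum, Finset.sum_sub_distrib,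
    ← Finset.mul_sum, hh.sum_eq_one]
  simp only [Finset.sum_const, Finset.card_univ, nsmul_eq_mul, ← hNdef]
  field_simp
  norm_num

lemma av_reachedCount_succ_le [Nonempty X] (hh : IsRandomMap h p) (k : ℕ) :
    av (fun ω => reachedCount (k + 1) (h ω)) ≤ av (fun ω => reachedCount k (h ω)) -
      (1 / (24 * Fintype.card X)) *
        av (fun ω => reachedCount k (h ω) ^ 2 - (2 * k + 1) * reachedCount k (h ω)) := by
  have hN : (0 : ℝ) < Fintype.card X := by exact_mod_cast Fintype.card_pos
  set N : ℝ := (Fintype.card X : ℝ) with hNdef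
  set O := (Finset.univ : Finset X).offDiag with hO
  set m : X → ℝ := fun y => 1 + N * p y with hm
  have hm1 : ∀ y, 1 ≤ m y := fun y => by
    have := hh.nonneg y
    simp only [hm]
    linarith [mul_nonneg hN.le this]
  set Λ : ℝ := av (fun ω => ∑ q ∈ O, ind (PairReached k (h ω) q.1 q.2)) with hΛ
  have hΛ0 : 0 ≤ Λ := av_nonneg fun ω => Finset.sum_nonneg fun q _ => ind_nonneg _
  have hΛ1 : av (fun ω => reachedCount k (h ω) ^ 2 - (2 * k + 1) * reachedCount k (h ω)) ≤ Λ :=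
    av_mono fun ω => sq_reachedCount_le k (h ω)
  have hstep := av_mono fun ω => reachedCount_succ_le k (h ω) hm1
  rw [av_add, av_sub, av_sum, av_sum] at hstep
  have hpair : ∀ y, av (fun ω => 1 / (4 * m y) * ∑ q ∈ O,
      ind (PairReached k (h ω) q.1 q.2) * ind (h ω q.1 = y) * ind (h ω q.2 = y)) =
      1 / (4 * m y) * p y ^ 2 * Λ := by
    intro y
    rw [av_const_mul, av_sum, hΛ, av_sum, mul_assoc, Finset.mul_sum (a := p y ^ 2)]
    congr 1
    refine Finset.sum_congr rfl fun q hq => ?_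
    have hne : q.1 ≠ q.2 := by simpa [hO] using hq
    exact hh.av_pair hne y (fun φ => ind (PairReached k φ q.1 q.2))
      (fun φ x => ind_congr (pairReached_update_left k φ q.1 q.2 x))
      (fun φ x => ind_congr (pairReached_update_right k φ q.1 q.2 x))
  have htri : ∀ y, av (fun ω => 1 / (12 * m y ^ 2) * ∑ q ∈ O,
      (ind (PairReached k (h ω) q.1 q.2) * ∑ x ∈ Finset.univ \ {q.1, q.2}, ind (h ω x = y)) *
        ind (h ω q.1 = y) * ind (h ω q.2 = y)) ≤
      1 / (12 * N ^ 2) * av (fun ω => ∑ q ∈ O, ind (PairReached k (h ω) q.1 q.2) *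
        ∑ x, ind (h ω x = y)) := by
    intro y
    rw [av_const_mul, av_sum, av_sum, Finset.mul_sum, Finset.mul_sum]
    refine Finset.sum_le_sum fun q hq => ?_
    have hne : q.1 ≠ q.2 := by simpa [hO] using hq
    rw [hh.av_pair hne y (fun φ => ind (PairReached k φ q.1 q.2) *
        ∑ x ∈ Finset.univ \ {q.1, q.2}, ind (φ x = y))
      (fun φ x => by
        rw [ind_congr (pairReached_update_left k φ q.1 q.2 x)]
        congr 1
        refine Finset.sum_congr rfl fun w hw => ?_
        rw [Function.update_of_ne (by rintro rfl; simp at hw)])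
      (fun φ x => by
        rw [ind_congr (pairReached_update_right k φ q.1 q.2 x)]
        congr 1
        refine Finset.sum_congr rfl fun w hw => ?_
        rw [Function.update_of_ne (by rintro rfl; simp at hw)]), ← mul_assoc]
    have hmono : av (fun ω => ind (PairReached k (h ω) q.1 q.2) *
        ∑ x ∈ Finset.univ \ {q.1, q.2}, ind (h ω x = y)) ≤
        av (fun ω => ind (PairReached k (h ω) q.1 q.2) * ∑ x, ind (h ω x = y)) :=
      av_mono fun ω => mul_le_mul_of_nonneg_left
        (Finset.sum_le_sum_of_subset_of_nonneg (Finset.subset_univ _)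
          fun _ _ _ => ind_nonneg _) (ind_nonneg _)
    refine mul_le_mul ?_ hmono (av_nonneg fun ω => mul_nonneg (ind_nonneg _)
      (Finset.sum_nonneg fun _ _ => ind_nonneg _)) (by positivity)
    have h0 := hh.nonneg y
    have hmy : 0 < m y := by linarith [hm1 y]
    rw [div_mul_eq_mul_div, one_mul, div_le_div_iff₀ (by positivity) (by positivity)]
    have : N * p y ≤ m y := by simp only [hm]; linarith
    have h2 : (N * p y) ^ 2 ≤ m y ^ 2 := pow_le_pow_left₀ (by positivity) this 2
    nlinarith
  have hfull : ∑ y, av (fun ω => ∑ q ∈ O, ind (PairReached k (h ω) q.1 q.2) *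
        ∑ x, ind (h ω x = y)) = N * Λ := by
    rw [← av_sum, hΛ, ← av_const_mul]
    congr 1
    funext ω
    rw [Finset.sum_comm, Finset.mul_sum]
    refine Finset.sum_congr rfl fun q _ => ?_
    rw [← Finset.mul_sum, Finset.sum_comm]
    have : ∀ x ∈ (Finset.univ : Finset X), ∑ y, ind (h ω x = y) = 1 := fun x _ => by simp [ind]
    rw [Finset.sum_congr rfl this]
    simp [hNdef, mul_comm]
  have htri' := Finset.sum_le_sum (s := (Finset.univ : Finset X)) fun y _ => htri y
  rw [← Finset.mul_sum, hfull] at htri'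
  rw [Finset.sum_congr rfl fun y _ => hpair y, ← Finset.sum_mul] at hstep
  have hw := mul_le_mul_of_nonneg_right hh.sum_collision_weights hΛ0
  have e1 : 1 / (12 * N ^ 2) * (N * Λ) = 1 / (12 * N) * Λ := by field_simp
  have e2 : 1 / (24 * N) * Λ = 1 / (8 * N) * Λ - 1 / (12 * N) * Λ := by field_simp; ring
  have e3 : 1 / (24 * N) * av (fun ω => reachedCount k (h ω) ^ 2 -
      (2 * k + 1) * reachedCount k (h ω)) ≤ 1 / (24 * N) * Λ :=
    mul_le_mul_of_nonneg_left hΛ1 (by positivity)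
  linarith

lemma av_reachedCount_le [Nonempty Ω] [Nonempty X] (hh : IsRandomMap h p) (K k : ℕ)
    (hk : k ≤ K) :
    av (fun ω => reachedCount k (h ω)) ≤
      48 * Fintype.card X / (k + 1) + 2 * (2 * K + 1) := by
  have hN : (0 : ℝ) < Fintype.card X := by exact_mod_cast Fintype.card_pos
  set N : ℝ := (Fintype.card X : ℝ) with hNdef
  suffices hs : av (fun ω => reachedCount k (h ω)) ≤ 2 * (2 * K + 1) ∨
      av (fun ω => reachedCount k (h ω)) ≤ 48 * N / (k + 1) by
    rcases hs with hs | hs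
    · have : 0 ≤ 48 * N / ((k : ℝ) + 1) := by positivity
      linarith
    · have : (0 : ℝ) ≤ 2 * (2 * K + 1) := by positivity
      linarith
  induction k with
  | zero =>
    right
    refine av_le_of_le (by positivity) fun ω => ?_
    have : reachedCount 0 (h ω) ≤ N := by
      refine (Finset.sum_le_sum fun z _ => ind_le_one _).trans ?_
      simp [hNdef]
    simp only [Nat.cast_zero, zero_add, div_one]
    linarith
  | succ k ih =>
    set t := av (fun ω => reachedCount k (h ω)) with ht
    by_cases hbig : t ≤ 2 * (2 * K + 1)
    · left
      exact (av_mono fun ω => reachedCount_succ_le_self k (h ω)).trans hbig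
    right
    push Not at hbig
    have iht : t ≤ 48 * N / (k + 1) := (ih (by omega)).resolve_left (by linarith)
    have hstep := hh.av_reachedCount_succ_le k
    rw [av_sub, av_const_mul, ← ht] at hstep
    have hsq : t ^ 2 ≤ av (fun ω => reachedCount k (h ω) ^ 2) := av_sq_le _
    have hkK : (k : ℝ) + 1 ≤ K := by exact_mod_cast hk
    have ht0 : 0 < t := by
      have : (0 : ℝ) ≤ K := Nat.cast_nonneg _
      linarith
    have h1 : t ^ 2 / 2 ≤ av (fun ω => reachedCount k (h ω) ^ 2) - (2 * k + 1) * t := by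
      nlinarith
    have h2 : av (fun ω => reachedCount (k + 1) (h ω)) ≤ t - 1 / (24 * N) * (t ^ 2 / 2) := by
      refine hstep.trans ?_
      have := mul_le_mul_of_nonneg_left h1 (by positivity : 0 ≤ 1 / (24 * N))
      linarith
    refine h2.trans ?_
    have hk0 : (0 : ℝ) < k + 1 := by positivity
    rw [le_div_iff₀ hk0] at iht
    push_cast
    rw [le_div_iff₀ (by positivity)]
    have e : (t - 1 / (24 * N) * (t ^ 2 / 2)) * ((k : ℝ) + 1 + 1) =
      (t * (k + 1) * (48 * N - t) + t * (48 * N - t)) / (48 * N) := by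
      field_simp
      ring
    rw [e, div_le_iff₀ (by positivity)]
    by_cases h48 : t ≤ 48 * N
    · have := mul_le_mul_of_nonneg_right iht (sub_nonneg.mpr h48)
      nlinarith [sq_nonneg t]
    · push Not at h48
      have : 0 < t * (k + 1) := by positivity
      nlinarith

/-- The law of the first return of a path to one of its earlier points. -/
lemma av_first_repeat (hh : IsRandomMap h p) (y : X) {m i₀ : ℕ} (hi : i₀ ≤ m) :
    av (fun ω => ind ((∀ i < m, (h ω)^[i] y ≠ (h ω)^[m] y) ∧
        (h ω)^[m + 1] y = (h ω)^[i₀] y)) ≤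
      av (fun ω => p ((h ω)^[i₀] y)) := by
  have hup : ∀ (φ : X → X) (z x : X), (∀ i < m, φ^[i] y ≠ z) → ∀ i ≤ m,
      (Function.update φ z x)^[i] y = φ^[i] y := fun φ z x hz =>
    iterate_eq_of_eqOn_path fun i hi => by rw [Function.update_of_ne (hz i hi)]
  have hiff : ∀ (φ : X → X) (z x : X),
      ((∀ i < m, (Function.update φ z x)^[i] y ≠ z) ∧ (Function.update φ z x)^[m] y = z) ↔
      ((∀ i < m, φ^[i] y ≠ z) ∧ φ^[m] y = z) := by
    intro φ z x
    constructor
    · rintro ⟨h1, h2⟩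
      have := hup (Function.update φ z x) z (φ z) h1
      simp only [Function.update_idem, Function.update_eq_self] at this
      exact ⟨fun i hi => by rw [this i hi.le]; exact h1 i hi, by rw [this m le_rfl, h2]⟩
    · rintro ⟨h1, h2⟩
      have := hup φ z x h1
      exact ⟨fun i hi => by rw [this i hi.le]; exact h1 i hi, by rw [this m le_rfl, h2]⟩
  let H : X → (X → X) → X → ℝ := fun z φ x =>
    ind ((∀ i < m, φ^[i] y ≠ z) ∧ φ^[m] y = z) * ind (x = φ^[i₀] y)
  have hH : ∀ z φ x x', H z (Function.update φ z x) x' = H z φ x' := by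
    intro z φ x x'
    simp only [H, ind_congr (hiff φ z x)]
    by_cases hB : (∀ i < m, φ^[i] y ≠ z) ∧ φ^[m] y = z
    · rw [hup φ z x hB.1 i₀ hi]
    · rw [ind_of_not hB]; simp
  have e1 : ∀ ω, ind ((∀ i < m, (h ω)^[i] y ≠ (h ω)^[m] y) ∧ (h ω)^[m + 1] y = (h ω)^[i₀] y) =
      ∑ z, H z (h ω) (h ω z) := by
    intro ω
    rw [Finset.sum_eq_single ((h ω)^[m] y)]
    · simp only [H, ← ind_and, Function.iterate_succ_apply', and_true]
    · intro z _ hz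
      simp only [H]
      rw [ind_of_not fun hc => hz hc.2.symm, zero_mul]
    · simp
  simp_rw [e1]
  rw [av_sum, Finset.sum_congr rfl fun z _ => hh.av_apply z (H z) (hH z), ← av_sum]
  refine av_mono fun ω => ?_
  have e2 : ∀ z, ∑ x, p x * H z (h ω) x =
      ind ((∀ i < m, (h ω)^[i] y ≠ z) ∧ (h ω)^[m] y = z) * p ((h ω)^[i₀] y) := by
    intro z
    simp only [H, ind]
    simp [mul_comm]
  simp_rw [e2]
  rw [← Finset.sum_mul]
  refine mul_le_of_le_one_left (hh.nonneg _) ?_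
  rw [Finset.sum_eq_single ((h ω)^[m] y)]
  · exact ind_le_one _
  · intro z _ hz
    exact ind_of_not fun hc => hz hc.2.symm
  · simp

lemma av_card_cyclic_le [Nonempty Ω] (hh : IsRandomMap h p) (k : ℕ) :
    av (fun ω => ∑ y, ind (∃ j ∈ Finset.Icc 1 k, (h ω)^[j] y = y)) ≤ k := by
  have h1 : ∀ ω y, ind (∃ j ∈ Finset.Icc 1 k, (h ω)^[j] y = y) ≤
      ∑ m ∈ Finset.range k, ind ((∀ i < m, (h ω)^[i] y ≠ (h ω)^[m] y) ∧
        (h ω)^[m + 1] y = (h ω)^[0] y) := by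
    intro ω y
    refine le_trans (ind_mono ?_) (ind_exists_mem_le _ _)
    rintro ⟨j, hj, hjy⟩
    have hex : ∃ j, 1 ≤ j ∧ (h ω)^[j] y = y := ⟨j, (Finset.mem_Icc.mp hj).1, hjy⟩
    have hspec := Nat.find_spec hex
    have hle : Nat.find hex ≤ j := Nat.find_min' hex ⟨(Finset.mem_Icc.mp hj).1, hjy⟩
    obtain ⟨m, hm⟩ : ∃ m, Nat.find hex = m + 1 := ⟨Nat.find hex - 1, by omega⟩
    have hjk := (Finset.mem_Icc.mp hj).2
    refine ⟨m, Finset.mem_range.mpr (by omega), fun i hi he => ?_, ?_⟩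
    · refine Nat.find_min hex (m := i + 1) (by omega) ⟨by omega, ?_⟩
      rw [Function.iterate_succ_apply', he, ← Function.iterate_succ_apply' (h ω)]
      change (h ω)^[m + 1] y = y
      rw [← hm]
      exact hspec.2
    · change (h ω)^[m + 1] y = y
      rw [← hm]; exact hspec.2
  refine (av_mono fun ω => Finset.sum_le_sum fun y _ => h1 ω y).trans ?_
  simp_rw [av_sum]
  rw [Finset.sum_comm]
  calc _ ≤ ∑ m ∈ Finset.range k, ∑ y, p y := by
        refine Finset.sum_le_sum fun m _ => Finset.sum_le_sum fun y _ => ?_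
        refine (hh.av_first_repeat y (Nat.zero_le m)).trans ?_
        simp only [Function.iterate_zero, id_eq]
        exact (av_const _).le
    _ = k := by simp [hh.sum_eq_one]

/-- The expected image size of the `k`-th iterate of a random map. -/
lemma av_card_image_iterate_le [Nonempty Ω] [Nonempty X] (hh : IsRandomMap h p) {k : ℕ}
    (hk : 1 ≤ k) :
    av (fun ω => ((Finset.univ.image (h ω)^[k]).card : ℝ)) ≤
      48 * Fintype.card X / k + 7 * k := by
  have h1 : ∀ ω, ((Finset.univ.image (h ω)^[k]).card : ℝ) ≤
      reachedCount k (h ω) + ∑ y, ind (∃ j ∈ Finset.Icc 1 k, (h ω)^[j] y = y) := by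
    intro ω
    have : ((Finset.univ.image (h ω)^[k]).card : ℝ) = ∑ y, ind (∃ u, (h ω)^[k] u = y) := by
      rw [sum_ind]
      congr 2
      ext y; simp
    rw [this, reachedCount, ← Finset.sum_add_distrib]
    refine Finset.sum_le_sum fun y _ => le_trans (ind_mono ?_) (ind_or_le _ _)
    rintro ⟨u, rfl⟩
    by_cases hr : ∀ i < k, (h ω)^[i] u ≠ (h ω)^[k] u
    · exact Or.inl ⟨u, rfl, hr⟩
    · push Not at hr
      obtain ⟨i, hi, he⟩ := hr
      refine Or.inr ⟨k - i, by simp; omega, ?_⟩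
      nth_rewrite 1 [← he]
      rw [← Function.iterate_add_apply, Nat.sub_add_cancel hi.le]
  refine (av_mono h1).trans ?_
  rw [av_add]
  have h2 := hh.av_reachedCount_le k k le_rfl
  have h3 := hh.av_card_cyclic_le k
  have h4 : 48 * (Fintype.card X : ℝ) / (k + 1) ≤ 48 * Fintype.card X / k := by
    have : (0 : ℝ) < k := by exact_mod_cast hk
    gcongr
    linarith
  have hk' : (1 : ℝ) ≤ k := by exact_mod_cast hk
  linarith

end IsRandomMap

end

section

lemma isRandomMap_id {V : Type*} [Fintype V] [Nonempty V] :
    IsRandomMap (fun f : V → V => f) (fun _ => 1 / (Fintype.card V : ℝ)) where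
  nonneg := fun _ => by positivity
  sum_eq_one := by simp
  resample := fun z Φ => by
    rw [av_update z Φ]
    congr 1
    funext g
    rw [← Finset.mul_sum, av]
    ring

/-- A uniformly random map, followed by a fixed map `F` and restricted to a subset. -/
lemma isRandomMap_comp {V X : Type*} [Fintype V] [Nonempty V] [Fintype X] (F : V → X)
    {ι : X → V} (hι : Function.Injective ι) :
    IsRandomMap (fun (g : V → V) (x : X) => F (g (ι x)))
      (fun x => (∑ y, ind (F y = x)) / (Fintype.card V : ℝ)) where
  nonneg := fun x => div_nonneg (Finset.sum_nonneg fun _ _ => ind_nonneg _) (Nat.cast_nonneg _)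
  sum_eq_one := by
    rw [← Finset.sum_div, Finset.sum_comm]
    simp [ind]
  resample := fun z Φ => by
    rw [av_update (ι z)]
    congr 1
    funext g
    have h1 : ∀ y : V, (fun x : X => F (Function.update g (ι z) y (ι x))) =
        Function.update (fun x => F (g (ι x))) z (F y) := by
      intro y
      funext x
      by_cases hx : x = z
      · subst hx; simp
      · have : ι x ≠ ι z := fun h => hx (hι h)
        simp [hx, this]
    simp_rw [h1]
    simp only [av, div_mul_eq_mul_div, ← Finset.sum_div, Finset.sum_mul]
    congr 1
    rw [Finset.sum_comm]
    exact Finset.sum_congr rfl fun y _ => (sum_ind_mul_of_eq (F y)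
      fun x => Φ (Function.update (fun x => F (g (ι x))) z x)).symm

section words

variable {V : Type*}

/-- The action of a word when the letters `false` and `true` act as `f` and `g`. -/
def act (f g : V → V) : List Bool → V → V
  | [], x => x
  | c :: w, x => act f g w (if c then g x else f x)

lemma act_append (f g : V → V) (w w' : List Bool) (x : V) :
    act f g (w ++ w') x = act f g w' (act f g w x) := by
  induction w generalizing x with
  | nil => rfl
  | cons c w ih => exact ih _

lemma act_replicate_false (f g : V → V) (k : ℕ) (x : V) :
    act f g (List.replicate k false) x = f^[k] x := by
  induction k generalizing x with
  | zero => rfl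
  | succ k ih => simp [List.replicate_succ, act, ih]

lemma act_map_not (f g : V → V) (w : List Bool) (x : V) :
    act f g (w.map not) x = act g f w x := by
  induction w generalizing x with
  | nil => rfl
  | cons c w ih => cases c <;> simp [act, ih]

/-- The word `(b a^K)^r`. -/
def powerWord (K : ℕ) : ℕ → List Bool
  | 0 => []
  | r + 1 => (true :: List.replicate K false) ++ powerWord K r

lemma length_powerWord (K r : ℕ) : (powerWord K r).length = r * (K + 1) := by
  induction r with
  | zero => simp [powerWord]
  | succ r ih => simp [powerWord, ih]; ring

lemma act_powerWord (f g : V → V) (K r : ℕ) (x : V) :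
    act f g (powerWord K r) x = (f^[K] ∘ g)^[r] x := by
  induction r generalizing x with
  | zero => rfl
  | succ r ih =>
    rw [powerWord, act_append, ih, Function.iterate_succ_apply]
    simp [act, act_replicate_false]

end words

/-- The word `a^K (b a^K)^r`. -/
def contractingWord (K r : ℕ) : List Bool := List.replicate K false ++ powerWord K r

lemma length_contractingWord (K r : ℕ) :
    (contractingWord K r).length = K + r * (K + 1) := by
  simp [contractingWord, length_powerWord]

variable {V : Type*} [Fintype V]

lemma av_card_image_contractingWord_le [Nonempty V] {K r : ℕ} (hK : 1 ≤ K) (hr : 1 ≤ r) :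
    av (fun f : V → V => av fun g : V → V =>
      ((Finset.univ.image (act f g (contractingWord K r))).card : ℝ)) ≤
      48 * (48 * Fintype.card V / K + 7 * K) / r + 7 * r := by
  have hr' : (0 : ℝ) < r := by exact_mod_cast hr
  have h1 : ∀ f : V → V, av (fun g : V → V =>
      ((Finset.univ.image (act f g (contractingWord K r))).card : ℝ)) ≤
      48 * ((Finset.univ.image f^[K]).card : ℝ) / r + 7 * r := by
    intro f
    let X := {x // x ∈ Finset.univ.image f^[K]}
    let F : V → X := fun y => ⟨f^[K] y, Finset.mem_image_of_mem _ (Finset.mem_univ _)⟩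
    have : Nonempty X := ⟨F (Classical.arbitrary V)⟩
    have h := (isRandomMap_comp F (ι := fun x : X => (x : V))
      Subtype.val_injective).av_card_image_iterate_le hr
    rw [Fintype.card_coe] at h
    refine le_trans (av_mono fun g => ?_) h
    have hcoe : ∀ k (x : X), (((fun x : X => F (g x))^[k] x : X) : V) = (f^[K] ∘ g)^[k] x := by
      intro k
      induction k with
      | zero => intro x; rfl
      | succ k ih => intro x; rw [Function.iterate_succ_apply, ih, Function.iterate_succ_apply]; rfl
    have himg : Finset.univ.image (act f g (contractingWord K r)) ⊆
        (Finset.univ.image (fun x : X => F (g x))^[r]).image Subtype.val := by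
      intro y hy
      obtain ⟨x, -, rfl⟩ := Finset.mem_image.mp hy
      rw [contractingWord, act_append, act_replicate_false, act_powerWord]
      refine Finset.mem_image.mpr ⟨(fun x : X => F (g x))^[r] (F x),
        Finset.mem_image_of_mem _ (Finset.mem_univ _), ?_⟩
      rw [hcoe]
    refine Nat.cast_le.mpr ((Finset.card_le_card himg).trans
      (Finset.card_image_le.trans (le_of_eq ?_)))
    congr!
  refine (av_mono h1).trans ?_
  rw [av_add]
  have h2 : av (fun f : V → V => 48 * ((Finset.univ.image f^[K]).card : ℝ) / r) =
      48 * av (fun f : V → V => ((Finset.univ.image f^[K]).card : ℝ)) / r := by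
    simp_rw [mul_div_assoc]
    rw [av_const_mul]
    simp_rw [div_eq_mul_inv]
    rw [av_mul_const]
  have h3 := (isRandomMap_id (V := V)).av_card_image_iterate_le hK
  rw [h2]
  gcongr
  exact av_const_le (by positivity)

end

section

section mergeable

variable {V : Type*}

/-- Two states are merged by a word of length at most `ℓ`. -/
def Mergeable (f g : V → V) (ℓ : ℕ) (x y : V) : Prop :=
  ∃ w : List Bool, w.length ≤ ℓ ∧ act f g w x = act f g w y

variable {f g : V → V} {ℓ ℓ' : ℕ} {x y : V}

lemma Mergeable.mono (h : Mergeable f g ℓ x y) (hℓ : ℓ ≤ ℓ') : Mergeable f g ℓ' x y := by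
  obtain ⟨w, hw, he⟩ := h
  exact ⟨w, hw.trans hℓ, he⟩

lemma Mergeable.symm (h : Mergeable f g ℓ x y) : Mergeable f g ℓ y x := by
  obtain ⟨w, hw, he⟩ := h
  exact ⟨w, hw, he.symm⟩

lemma Mergeable.swap (h : Mergeable f g ℓ x y) : Mergeable g f ℓ x y := by
  obtain ⟨w, hw, he⟩ := h
  exact ⟨w.map not, by simpa using hw, by rw [act_map_not, act_map_not, he]⟩

lemma Mergeable.cons_true (h : Mergeable f g ℓ (g x) (g y)) : Mergeable f g (ℓ + 1) x y := by
  obtain ⟨w, hw, he⟩ := h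
  exact ⟨true :: w, by simpa using hw, by simpa [act] using he⟩

lemma Mergeable.of_apply_true {x' y' : V} (h : Mergeable f g ℓ x' y') (hx : g x = x')
    (hy : g y = y') : Mergeable f g (ℓ + 1) x y := by
  subst hx hy
  exact h.cons_true

lemma Mergeable.of_iterate {i : ℕ} (h : Mergeable f g ℓ (f^[i] x) (f^[i] y)) :
    Mergeable f g (ℓ + i) x y := by
  obtain ⟨w, hw, he⟩ := h
  refine ⟨List.replicate i false ++ w, by simp; omega, ?_⟩
  rw [act_append, act_append, act_replicate_false, act_replicate_false, he]

lemma mergeable_of_iterate_eq {i : ℕ} (h : f^[i] x = f^[i] y) : Mergeable f g i x y := by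
  have : Mergeable f g 0 (f^[i] x) (f^[i] y) := ⟨[], le_rfl, h⟩
  simpa using this.of_iterate

/-- If all pairs can be merged by words of length at most `ℓ`, every set of states can be merged
by a word of length at most `ℓ` times its size. -/
lemma exists_word_card_image_eq_one (h : ∀ x y, Mergeable f g ℓ x y) (S : Finset V)
    (hS : S.Nonempty) : ∃ w : List Bool, w.length ≤ S.card * ℓ ∧
      (S.image (act f g w)).card = 1 := by
  induction hn : S.card using Nat.strong_induction_on generalizing S with
  | _ n ih =>
    by_cases h1 : S.card = 1
    · refine ⟨[], by simp, ?_⟩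
      have : S.image (act f g []) = S := by
        ext z; simp [act]
      rw [this, h1]
    · have hpos := hS.card_pos
      obtain ⟨x, hx, y, hy, hxy⟩ := Finset.one_lt_card.mp (show 1 < S.card by omega)
      obtain ⟨w, hw, he⟩ := h x y
      have hlt : (S.image (act f g w)).card < S.card := by
        refine lt_of_le_of_ne Finset.card_image_le fun hc => hxy ?_
        exact Finset.injOn_of_card_image_eq hc hx hy he
      obtain ⟨w', hw', hc⟩ := ih _ (by omega) (S.image (act f g w)) (hS.image _) rfl
      refine ⟨w ++ w', ?_, ?_⟩
      · rw [List.length_append]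
        have : (S.image (act f g w)).card + 1 ≤ n := by omega
        calc _ ≤ ℓ + (S.image (act f g w)).card * ℓ := by omega
          _ = ((S.image (act f g w)).card + 1) * ℓ := by ring
          _ ≤ n * ℓ := Nat.mul_le_mul_right _ this
      · rw [← hc, Finset.image_image]
        congr 2
        funext z
        exact act_append f g w w' z

end mergeable

variable {V : Type*}

/-- The map equal to `g₀` on `Q` and to `g` elsewhere. -/
noncomputable def mix (Q : Finset V) (g₀ g : V → V) : V → V := fun z => if z ∈ Q then g₀ z else g z

lemma mix_update {Q : Finset V} {g₀ g : V → V} {u U : V} (hu : u ∉ Q) :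
    mix Q g₀ (Function.update g u U) = mix (insert u Q) (Function.update g₀ u U) g := by
  funext z
  by_cases hz : z = u
  · subst hz; simp [mix, hu]
  · simp [mix, hz]

/-- `U, V` and their images under `f` are pairwise distinct and avoid `W`. -/
def Clean (f : V → V) (W : Finset V) (U U' : V) : Prop :=
  [U, U', f U, f U'].Nodup ∧ ∀ z ∈ [U, U', f U, f U'], z ∉ W

/-- The list of states occurring in a list of ranked pairs. -/
def nodes (L : List (V × V × ℕ)) : List V := L.flatMap fun p => [p.1, p.2.1]

lemma nodes_cons (p : V × V × ℕ) (L : List (V × V × ℕ)) :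
    nodes (p :: L) = p.1 :: p.2.1 :: nodes L := rfl

/-- No pair in the list can be merged by a word of length dictated by its rank. -/
def Stuck (f g : V → V) (I : ℕ) (L : List (V × V × ℕ)) : Prop :=
  ∀ p ∈ L, ¬Mergeable f g (2 * p.2.2 + 1 + I) p.1 p.2.1

variable [Fintype V]

lemma av_stuck_le {f : V → V} {I w : ℕ} {θ : ℕ → ℝ} {κ γ : ℝ} (hκ1 : κ ≤ 1)
    (hθ : ∀ r, 0 ≤ θ r) (hθ1 : ∀ r, θ r ≤ 1)
    (hclean : ∀ W : Finset V, W.card ≤ w →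
      av (fun U => av fun U' => ind (¬Clean f W U U')) ≤ γ)
    (hmerge : av (fun U => av fun U' => ind (¬f^[I] U = f^[I] U')) ≤ 1 - κ)
    (hzero : 1 - κ ≤ θ 0) (hsucc : ∀ r, γ + (1 - γ) * θ r ^ 2 ≤ θ (r + 1))
    (t : ℕ) (L : List (V × V × ℕ)) (Q : Finset V) (g₀ : V → V)
    (hnodup : (nodes L).Nodup) (hdisj : ∀ z ∈ nodes L, z ∉ Q)
    (hw : Q.card + (nodes L).length + 4 * t ≤ w) :
    av (fun g => ind (Stuck f (mix Q g₀ g) I L)) ≤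
      (L.map fun p => θ p.2.2).prod + (1 - κ) ^ t := by
  have hprod : ∀ L : List (V × V × ℕ), 0 ≤ (L.map fun p => θ p.2.2).prod := fun L =>
    List.prod_nonneg (by simp only [List.mem_map]; rintro a ⟨p, -, rfl⟩; exact hθ _)
  induction t generalizing L Q g₀ with
  | zero =>
    rw [pow_zero]
    refine (av_le_of_le zero_le_one fun g => ind_le_one _).trans ?_
    have := hprod L
    linarith
  | succ t ih =>
    rcases L with - | ⟨⟨u, v, r⟩, L⟩
    · simp only [List.map_nil, List.prod_nil]
      refine (av_le_of_le zero_le_one fun g => ind_le_one _).trans ?_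
      have : 0 ≤ (1 - κ) ^ (t + 1) := pow_nonneg (by linarith) _
      linarith
    rw [nodes_cons, List.nodup_cons, List.nodup_cons] at hnodup
    obtain ⟨hu, hv, hL⟩ := hnodup
    simp only [List.mem_cons, not_or] at hu
    simp only [nodes_cons, List.mem_cons, forall_eq_or_imp] at hdisj
    obtain ⟨huQ, hvQ, hLQ⟩ := hdisj
    simp only [nodes_cons, List.length_cons] at hw
    set Q' := insert u (insert v Q) with hQ'
    have hcardQ' : Q'.card = Q.card + 2 := by
      rw [hQ', Finset.card_insert_of_notMem, Finset.card_insert_of_notMem hvQ]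
      simp [hu.1, huQ]
    have hLQ' : ∀ z ∈ nodes L, z ∉ Q' := by
      intro z hz
      simp only [hQ', Finset.mem_insert, not_or]
      exact ⟨fun h => hu.2 (h ▸ hz), fun h => hv (h ▸ hz), hLQ z hz⟩
    set W := Q' ∪ (nodes L).toFinset with hW
    have hcardW : W.card ≤ w := by
      have h1 := Finset.card_union_le Q' (nodes L).toFinset
      have h2 := List.toFinset_card_le (nodes L)
      rw [hW]
      omega
    set G : V → V → V → V := fun U U' => Function.update (Function.update g₀ v U') u U with hG
    have hmix : ∀ g U U', mix Q g₀ (Function.update (Function.update g u U) v U') =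
        mix Q' (G U U') g := by
      intro g U U'
      rw [mix_update hvQ, mix_update (by simp [hu.1, huQ])]
    have hGu : ∀ g U U', mix Q' (G U U') g u = U := fun g U U' => by simp [mix, hQ', hG]
    have hGv : ∀ g U U', mix Q' (G U U') g v = U' := fun g U U' => by
      simp [mix, hQ', hG, Function.update_of_ne (Ne.symm hu.1)]
    have hrev : av (fun g => ind (Stuck f (mix Q g₀ g) I ((u, v, r) :: L))) =
        av (fun U => av fun U' => av fun g =>
          ind (Stuck f (mix Q' (G U U') g) I ((u, v, r) :: L))) := by
      rw [av_update v]
      simp_rw [mix_update hvQ]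
      rw [av_comm]
      have : ∀ U', av (fun g => ind (Stuck f (mix (insert v Q) (Function.update g₀ v U') g) I
          ((u, v, r) :: L))) = av (fun U => av fun g =>
            ind (Stuck f (mix Q' (G U U') g) I ((u, v, r) :: L))) := by
        intro U'
        rw [av_update u]
        simp_rw [mix_update (show u ∉ insert v Q by simp [hu.1, huQ])]
        rw [av_comm]
      simp_rw [this]
      rw [av_comm]
    rw [hrev, List.map_cons, List.prod_cons]
    set π := (L.map fun p => θ p.2.2).prod with hπ
    have hπ0 : 0 ≤ π := hprod L
    have hbase : 0 ≤ (1 - κ) ^ t := pow_nonneg (by linarith) _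
    -- merging at once
    have hA : ∀ U U', f^[I] U = f^[I] U' → av (fun g =>
        ind (Stuck f (mix Q' (G U U') g) I ((u, v, r) :: L))) ≤ 0 := by
      intro U U' hUU
      refine av_le_of_le le_rfl fun g => (ind_of_not fun hs => ?_).le
      refine hs (u, v, r) (by simp) ?_
      exact ((mergeable_of_iterate_eq hUU).of_apply_true (hGu g U U') (hGv g U U')).mono
        (by simp only; omega)
    -- dropping the pair
    have hB : ∀ U U', av (fun g =>
        ind (Stuck f (mix Q' (G U U') g) I ((u, v, r) :: L))) ≤ π + (1 - κ) ^ t := by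
      intro U U'
      refine le_trans (av_mono fun g => ind_mono (q := Stuck f (mix Q' (G U U') g) I L)
        fun hs p hp => hs p (List.mem_cons_of_mem _ hp)) ?_
      exact ih L Q' (G U U') hL hLQ' (by omega)
    rcases r with - | r
    · have hpt : ∀ U U', av (fun g =>
          ind (Stuck f (mix Q' (G U U') g) I ((u, v, 0) :: L))) ≤
            ind (¬f^[I] U = f^[I] U') * (π + (1 - κ) ^ t) := by
        intro U U'
        by_cases hUU : f^[I] U = f^[I] U'
        · rw [ind_of_not (by simpa using hUU), zero_mul]; exact hA U U' hUU
        · rw [ind_of_true hUU, one_mul]; exact hB U U'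
      refine (av_mono fun U => av_mono fun U' => hpt U U').trans ?_
      simp_rw [av_mul_const]
      calc _ ≤ (1 - κ) * (π + (1 - κ) ^ t) := by gcongr
        _ = (1 - κ) * π + (1 - κ) ^ (t + 1) := by ring
        _ ≤ _ := by gcongr
    · have hC : ∀ U U', Clean f W U U' → av (fun g =>
          ind (Stuck f (mix Q' (G U U') g) I ((u, v, r + 1) :: L))) ≤
            π * θ r ^ 2 + (1 - κ) ^ t := by
        intro U U' hcl
        have h1 := ih ((U, U', r) :: (f U, f U', r) :: L) Q' (G U U') (by
            simp only [nodes_cons]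
            obtain ⟨hnd, hav⟩ := hcl
            have : ([U, U', f U, f U'] ++ nodes L).Nodup := by
              refine List.Nodup.append hnd hL fun z hz hz' => hav z hz ?_
              simp [hW, hz']
            simpa using this) (by
            intro z hz
            have hz' : z ∈ [U, U', f U, f U'] ++ nodes L := by simpa [nodes_cons] using hz
            rcases List.mem_append.mp hz' with hz' | hz'
            · exact fun hq => hcl.2 z hz' (by simp [hW, hq])
            · exact hLQ' z hz') (by
            simp only [nodes_cons, List.length_cons]
            omega)
        rw [List.map_cons, List.map_cons, List.prod_cons, List.prod_cons, ← hπ] at h1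
        refine le_trans (av_mono fun g => ind_mono fun hs => ?_)
          (h1.trans (le_of_eq (by simp only; ring)))
        have h0 := hs (u, v, r + 1) (by simp)
        simp only at h0
        have key : ¬Mergeable f (mix Q' (G U U') g) (2 * r + 1 + I + 1) U U' := by
          intro hm
          exact h0 ((hm.of_apply_true (hGu g U U') (hGv g U U')).mono (by omega))
        intro p hp
        simp only [List.mem_cons] at hp
        rcases hp with rfl | rfl | hp
        · exact fun hm => key (hm.mono (by simp only; omega))
        · exact fun hm => key (Mergeable.of_iterate (i := 1) hm)
        · exact hs p (by simp [hp])
      have hpt : ∀ U U', av (fun g =>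
          ind (Stuck f (mix Q' (G U U') g) I ((u, v, r + 1) :: L))) ≤
            π * θ r ^ 2 + π * (1 - θ r ^ 2) * ind (¬Clean f W U U') +
              ind (¬f^[I] U = f^[I] U') * (1 - κ) ^ t := by
        intro U U'
        have hsq : θ r ^ 2 ≤ 1 := pow_le_one₀ (hθ r) (hθ1 r)
        have hn1 : 0 ≤ π * θ r ^ 2 := by positivity
        have hn2 : 0 ≤ π * (1 - θ r ^ 2) := mul_nonneg hπ0 (by linarith)
        by_cases hUU : f^[I] U = f^[I] U'
        · refine (hA U U' hUU).trans ?_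
          have h1 := mul_nonneg hn2 (ind_nonneg (¬Clean f W U U'))
          have h2 := mul_nonneg (ind_nonneg (¬f^[I] U = f^[I] U')) hbase
          linarith
        · rw [ind_of_true hUU, one_mul]
          by_cases hcl : Clean f W U U'
          · rw [ind_of_not (by simpa using hcl), mul_zero, add_zero]; exact hC U U' hcl
          · rw [ind_of_true hcl]
            refine (hB U U').trans (le_of_eq ?_)
            ring
      refine (av_mono fun U => av_mono fun U' => hpt U U').trans ?_
      have : Nonempty V := ⟨u⟩
      simp_rw [av_add, av_mul_const, av_const_mul, av_const]
      have hsq : θ r ^ 2 ≤ 1 := pow_le_one₀ (hθ r) (hθ1 r)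
      have hn2 : 0 ≤ π * (1 - θ r ^ 2) := mul_nonneg hπ0 (by linarith)
      calc _ ≤ π * θ r ^ 2 + π * (1 - θ r ^ 2) * γ + (1 - κ) * (1 - κ) ^ t := by
            gcongr
            exact hclean W hcardW
        _ = (γ + (1 - γ) * θ r ^ 2) * π + (1 - κ) ^ (t + 1) := by ring
        _ ≤ _ := by gcongr; exact hsucc r

end

section

variable {V : Type*}

/-- Among `3 * m` pairs of entries of two injective sequences which never agree at the same index,
one can choose `m` pairs without common entries. -/
lemma exists_disjoint_pairs {a b : ℕ → V} (m : ℕ) (S : Finset ℕ) (ha : Set.InjOn a S)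
    (hb : Set.InjOn b S) (hab : ∀ i ∈ S, a i ≠ b i) (R : ℕ) (hS : 3 * m ≤ S.card) :
    ∃ L : List (V × V × ℕ), L.length = m ∧ (nodes L).Nodup ∧
      ∀ p ∈ L, ∃ i ∈ S, p = (a i, b i, R) := by
  induction m generalizing S with
  | zero => exact ⟨[], rfl, by simp [nodes], by simp⟩
  | succ m ih =>
    obtain ⟨i, hi⟩ : S.Nonempty := Finset.card_pos.mp (by omega)
    set T := S.filter fun j => j ≠ i ∧ a j ≠ b i ∧ b j ≠ a i with hT
    have hTS : T ⊆ S := Finset.filter_subset _ _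
    have hcard : S.card ≤ T.card + 3 := by
      have hsub : S ⊆ T ∪ ({i} ∪ ((S.filter fun j => a j = b i) ∪ S.filter fun j => b j = a i)) := by
        intro j hj
        simp only [hT, Finset.mem_union, Finset.mem_filter, Finset.mem_singleton]
        tauto
      have h1 : (S.filter fun j => a j = b i).card ≤ 1 := by
        refine Finset.card_le_one.mpr fun j hj k hk => ?_
        rw [Finset.mem_filter] at hj hk
        exact ha hj.1 hk.1 (hj.2.trans hk.2.symm)
      have h2 : (S.filter fun j => b j = a i).card ≤ 1 := by
        refine Finset.card_le_one.mpr fun j hj k hk => ?_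
        rw [Finset.mem_filter] at hj hk
        exact hb hj.1 hk.1 (hj.2.trans hk.2.symm)
      have h3 := Finset.card_le_card hsub
      have h4 := Finset.card_union_le T
        ({i} ∪ ((S.filter fun j => a j = b i) ∪ S.filter fun j => b j = a i))
      have h5 := Finset.card_union_le {i}
        ((S.filter fun j => a j = b i) ∪ S.filter fun j => b j = a i)
      have h6 := Finset.card_union_le (S.filter fun j => a j = b i) (S.filter fun j => b j = a i)
      have h7 := Finset.card_singleton i
      omega
    obtain ⟨L, hlen, hnd, hmem⟩ := ih T (ha.mono hTS) (hb.mono hTS)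
      (fun j hj => hab j (hTS hj)) (by omega)
    have hnodes : ∀ z ∈ nodes L, ∃ j ∈ T, z = a j ∨ z = b j := by
      intro z hz
      simp only [nodes, List.mem_flatMap] at hz
      obtain ⟨p, hp, hz⟩ := hz
      obtain ⟨j, hj, rfl⟩ := hmem p hp
      exact ⟨j, hj, by simpa using hz⟩
    refine ⟨(a i, b i, R) :: L, by simp [hlen], ?_, ?_⟩
    · rw [nodes_cons, List.nodup_cons, List.nodup_cons]
      refine ⟨?_, ?_, hnd⟩
      · simp only [List.mem_cons, not_or]
        refine ⟨hab i hi, fun hz => ?_⟩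
        obtain ⟨j, hj, h⟩ := hnodes _ hz
        have hj' := Finset.mem_filter.mp hj
        rcases h with h | h
        · exact hj'.2.1 (ha hj'.1 hi h.symm)
        · exact hj'.2.2.2 h.symm
      · intro hz
        obtain ⟨j, hj, h⟩ := hnodes _ hz
        have hj' := Finset.mem_filter.mp hj
        rcases h with h | h
        · exact hj'.2.2.1 h.symm
        · exact hj'.2.1 (hb hj'.1 hi h.symm)
    · intro p hp
      rcases List.mem_cons.mp hp with rfl | hp
      · exact ⟨i, hi, rfl⟩
      · obtain ⟨j, hj, h⟩ := hmem p hp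
        exact ⟨j, hTS hj, h⟩

lemma length_nodes (L : List (V × V × ℕ)) : (nodes L).length = 2 * L.length := by
  induction L with
  | nil => rfl
  | cons p L ih => rw [nodes_cons]; simp [ih]; ring

variable [Fintype V]

/-- The number of ordered pairs of states with the same image. -/
noncomputable def collisions (f : V → V) : ℝ := ∑ z, ∑ z', ind (f z = f z')

lemma collisions_eq_sum_sq (f : V → V) :
    collisions f = ∑ y, (∑ z, ind (f z = y)) ^ 2 := by
  have h1 : ∀ y, (∑ z, ind (f z = y)) ^ 2 = ∑ z, ∑ z', ind (f z = y) * ind (f z' = y) := by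
    intro y
    rw [sq, Finset.sum_mul_sum]
  simp_rw [h1]
  rw [Finset.sum_comm, collisions]
  refine Finset.sum_congr rfl fun z _ => ?_
  rw [Finset.sum_comm]
  refine Finset.sum_congr rfl fun z' _ => ?_
  rw [sum_ind_mul_of_eq (f z) fun y => ind (f z' = y)]
  exact ind_congr ⟨Eq.symm, Eq.symm⟩

lemma sum_ind_eq_card (f : V → V) (W : Finset V) :
    ∑ y ∈ W, ∑ z, ind (f z = y) = ∑ z, ind (f z ∈ W) := by
  rw [Finset.sum_comm]
  refine Finset.sum_congr rfl fun z _ => ?_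
  simp [ind]

lemma sq_preimage_le (f : V → V) (W : Finset V) :
    (∑ z, ind (f z ∈ W)) ^ 2 ≤ W.card * collisions f := by
  rw [← sum_ind_eq_card, collisions_eq_sum_sq]
  refine sq_sum_le_card_mul_sum_sq.trans ?_
  gcongr
  exact Finset.subset_univ W

lemma sq_card_le_mul_collisions (f : V → V) :
    (Fintype.card V : ℝ) ^ 2 ≤ (Finset.univ.image f).card * collisions f := by
  have h := sq_preimage_le f (Finset.univ.image f)
  have h1 : ∑ z, ind (f z ∈ Finset.univ.image f) = Fintype.card V := by
    simp [ind]
  rwa [h1] at h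

lemma av_av_eq (F : V → V → ℝ) :
    av (fun U => av fun U' => F U U') = (∑ U, ∑ U', F U U') / (Fintype.card V : ℝ) ^ 2 := by
  simp only [av, ← Finset.sum_div]
  rw [div_div, sq]

lemma av_ne_le [Nonempty V] {φ : V → V} {κ : ℝ}
    (hκ : ((Finset.univ.image φ).card : ℝ) * κ ≤ 1) :
    av (fun U => av fun U' => ind (¬φ U = φ U')) ≤ 1 - κ := by
  have hn : (0 : ℝ) < Fintype.card V := by exact_mod_cast Fintype.card_pos
  simp_rw [ind_not, av_sub, av_const]
  have h := sq_card_le_mul_collisions φ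
  have h2 : av (fun U => av fun U' => ind (φ U = φ U')) =
    collisions φ / (Fintype.card V : ℝ) ^ 2 := av_av_eq _
  rw [h2]
  have hpos : (0 : ℝ) < (Finset.univ.image φ).card := by
    exact_mod_cast Finset.card_pos.mpr (Finset.univ_nonempty.image _)
  have : κ ≤ collisions φ / (Fintype.card V : ℝ) ^ 2 := by
    rw [le_div_iff₀ (by positivity)]
    have h3 : κ * (Fintype.card V : ℝ) ^ 2 * (Finset.univ.image φ).card ≤
        collisions φ * (Finset.univ.image φ).card := by
      calc _ = ((Finset.univ.image φ).card * κ) * (Fintype.card V : ℝ) ^ 2 := by ring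
        _ ≤ 1 * (Fintype.card V : ℝ) ^ 2 := by gcongr
        _ ≤ _ := by linarith
    exact le_of_mul_le_mul_right h3 hpos
  linarith

lemma av_not_clean_le {f : V → V} (hn : 1000 ≤ Fintype.card V)
    (hcol : collisions f ≤ 4 * Fintype.card V)
    (hfix : 100 * ∑ z, ind (z = f z) ≤ Fintype.card V) (W : Finset V)
    (hW : 1000 * W.card ≤ Fintype.card V) :
    av (fun U => av fun U' => ind (¬Clean f W U U')) ≤ 1 / 5 := by
  have hN : (1000 : ℝ) ≤ Fintype.card V := by exact_mod_cast hn
  have hW' : (1000 : ℝ) * W.card ≤ Fintype.card V := by exact_mod_cast hW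
  set N : ℝ := (Fintype.card V : ℝ) with hNdef
  set p := ∑ z, ind (f z ∈ W) with hp
  have hp0 : 0 ≤ p := Finset.sum_nonneg fun _ _ => ind_nonneg _
  have hpre : p ≤ N * (64 / 1000) := by
    have h1 := sq_preimage_le f W
    rw [← hp] at h1
    have h2 : (W.card : ℝ) * collisions f ≤ (N / 1000) * (4 * N) := by
      have : (W.card : ℝ) ≤ N / 1000 := by linarith
      have h0 : 0 ≤ collisions f := Finset.sum_nonneg fun _ _ => Finset.sum_nonneg fun _ _ =>
        ind_nonneg _
      gcongr
    refine abs_le_of_sq_le_sq' ?_ (by positivity) |>.2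
    nlinarith
  have hpt : ∀ U U', ind (¬Clean f W U U') ≤
      (ind (U ∈ W) + ind (f U ∈ W) + ind (U = f U)) +
      (ind (U' ∈ W) + ind (f U' ∈ W) + ind (U' = f U')) +
      (ind (U = U') + ind (f U = U') + ind (f U' = U) + ind (f U = f U')) := by
    intro U U'
    have h : ¬Clean f W U U' →
      ((U ∈ W ∨ f U ∈ W) ∨ U = f U) ∨ ((U' ∈ W ∨ f U' ∈ W) ∨ U' = f U') ∨
      (((U = U' ∨ f U = U') ∨ f U' = U) ∨ f U = f U') := by
      intro hc
      by_contra hcon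
      simp only [not_or] at hcon
      obtain ⟨⟨⟨h1, h2⟩, h3⟩, ⟨⟨h4, h5⟩, h6⟩, ⟨⟨h7, h8⟩, h9⟩, h10⟩ := hcon
      refine hc ⟨?_, ?_⟩
      · simp only [List.nodup_cons, List.mem_cons, List.not_mem_nil, or_false, not_or,
          not_false_eq_true, List.nodup_nil, and_true]
        exact ⟨⟨h7, h3, fun h => h9 h.symm⟩, ⟨fun h => h8 h.symm, h6⟩, h10⟩
      · simp [h1, h2, h4, h5]
    refine (ind_mono h).trans ?_
    refine (ind_or_le _ _).trans ?_
    rw [add_assoc]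
    have e1 := (ind_or_le (U ∈ W ∨ f U ∈ W) (U = f U))
    have e2 := ind_or_le (U ∈ W) (f U ∈ W)
    have e3 := ind_or_le ((U' ∈ W ∨ f U' ∈ W) ∨ U' = f U')
      (((U = U' ∨ f U = U') ∨ f U' = U) ∨ f U = f U')
    have e4 := (ind_or_le (U' ∈ W ∨ f U' ∈ W) (U' = f U'))
    have e5 := ind_or_le (U' ∈ W) (f U' ∈ W)
    have e6 := ind_or_le ((U = U' ∨ f U = U') ∨ f U' = U) (f U = f U')
    have e7 := ind_or_le (U = U' ∨ f U = U') (f U' = U)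
    have e8 := ind_or_le (U = U') (f U = U')
    linarith
  have hsum : (∑ U, ∑ U', ind (¬Clean f W U U')) ≤
      2 * N * (W.card + p + ∑ z, ind (z = f z)) + (N + N + N + collisions f) := by
    refine (Finset.sum_le_sum fun U _ => Finset.sum_le_sum fun U' _ => hpt U U').trans ?_
    have hcard : ∑ z, ind (z ∈ W) = W.card := by
      rw [sum_ind]; congr 2; ext z; simp
    have e1 : ∑ U : V, ∑ U' : V, ind (U = U') = N := by simp [ind, hNdef]
    have e2 : ∑ U : V, ∑ U' : V, ind (f U = U') = N := by simp [ind, hNdef]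
    have e3 : ∑ U : V, ∑ U' : V, ind (f U' = U) = N := by
      rw [Finset.sum_comm]; simp [ind, hNdef]
    simp only [Finset.sum_add_distrib, Finset.sum_const, Finset.card_univ, nsmul_eq_mul,
      ← Finset.mul_sum, hcard, e1, e2, e3, ← hNdef, ← hp]
    rw [collisions]
    linarith
  rw [av_av_eq, ← hNdef, div_le_iff₀ (by positivity)]
  refine hsum.trans ?_
  nlinarith

lemma av_not_mergeable_le {f : V → V} {I M N R : ℕ} {κ : ℝ} {x y : V}
    (hn : 1000 ≤ Fintype.card V) (hcol : collisions f ≤ 4 * Fintype.card V) (hκ0 : 0 < κ)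
    (him : ((Finset.univ.image f^[I]).card : ℝ) * κ ≤ 1) (hnκ : 100 ≤ κ * Fintype.card V)
    (hR : 1 / 4 ≤ (7 / 5 : ℝ) ^ R * κ) (hMN : 1000 * (2 * M + 4 * N) ≤ Fintype.card V)
    (hx : Set.InjOn (fun i => f^[i] x) (Finset.range (3 * M)))
    (hy : Set.InjOn (fun i => f^[i] y) (Finset.range (3 * M))) :
    av (fun g => ind (¬Mergeable f g (2 * R + 1 + I + 3 * M) x y)) ≤
      (3 / 4) ^ M + (1 - κ) ^ N := by
  have : Nonempty V := ⟨x⟩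
  have himpos : (1 : ℝ) ≤ (Finset.univ.image f^[I]).card := by
    exact_mod_cast Finset.card_pos.mpr (Finset.univ_nonempty.image _)
  have hκ1 : κ ≤ 1 := by nlinarith
  have hpow : 0 ≤ (1 - κ) ^ N := pow_nonneg (by linarith) _
  by_cases hmeet : ∃ i ∈ Finset.range (3 * M), f^[i] x = f^[i] y
  · obtain ⟨i, hi, he⟩ := hmeet
    have hi := Finset.mem_range.mp hi
    refine (av_le_of_le le_rfl fun g => (ind_of_not (not_not.mpr ?_)).le).trans (by positivity)
    exact (mergeable_of_iterate_eq he).mono (by omega)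
  push Not at hmeet
  obtain ⟨L, hlen, hnd, hmem⟩ := exists_disjoint_pairs M (Finset.range (3 * M)) hx hy hmeet R
    (by simp)
  set θ : ℕ → ℝ := fun r => 1 - min (1 / 4) ((7 / 5 : ℝ) ^ r * κ) with hθ
  have hq : ∀ r, 0 ≤ min (1 / 4) ((7 / 5 : ℝ) ^ r * κ) := fun r => by positivity
  have hq' : ∀ r, min (1 / 4) ((7 / 5 : ℝ) ^ r * κ) ≤ 1 / 4 := fun r => min_le_left _ _
  have hfix : 100 * ∑ z, ind (z = f z) ≤ Fintype.card V := by
    have h1 : ∑ z, ind (z = f z) ≤ (Finset.univ.image f^[I]).card := by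
      rw [sum_ind]
      refine Nat.cast_le.mpr (Finset.card_le_card fun z hz => ?_)
      have hz' : z = f z := (Finset.mem_filter.mp hz).2
      exact Finset.mem_image.mpr ⟨z, Finset.mem_univ _, Function.iterate_fixed hz'.symm I⟩
    have h2 : 100 * ((Finset.univ.image f^[I]).card : ℝ) * κ ≤ Fintype.card V * κ := by linarith
    have h3 := le_of_mul_le_mul_right h2 hκ0
    linarith
  have hmain := av_stuck_le (f := f) (I := I) (w := 2 * M + 4 * N) (θ := θ) (κ := κ) (γ := 1 / 5)
    hκ1 (fun r => by simp only [hθ]; linarith [hq' r]) (fun r => by simp only [hθ]; linarith [hq r])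
    (fun W hW => av_not_clean_le hn hcol hfix W (by omega)) (av_ne_le him)
    (by simp only [hθ, pow_zero, one_mul]; linarith [min_le_right (1 / 4) κ])
    (fun r => by
      simp only [hθ]
      have h1 : min (1 / 4) ((7 / 5 : ℝ) ^ (r + 1) * κ) ≤
          7 / 5 * min (1 / 4) ((7 / 5 : ℝ) ^ r * κ) := by
        rw [mul_min_of_nonneg _ _ (by norm_num), pow_succ]
        refine min_le_min (by norm_num) (le_of_eq (by ring))
      nlinarith [hq r, hq' r])
    N L ∅ id hnd (by simp) (by simp [length_nodes, hlen])
  have hprod : (L.map fun p => θ p.2.2).prod = (3 / 4) ^ M := by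
    have : L.map (fun p => θ p.2.2) = List.replicate M (3 / 4) := by
      rw [List.eq_replicate_iff]
      refine ⟨by simp [hlen], fun b hb => ?_⟩
      obtain ⟨p, hp, rfl⟩ := List.mem_map.mp hb
      obtain ⟨i, -, rfl⟩ := hmem p hp
      simp only [hθ, min_eq_left hR]
      norm_num
    rw [this, List.prod_replicate]
  rw [hprod] at hmain
  refine le_trans (av_mono fun g => ind_mono fun hm p hp hs => hm ?_) hmain
  obtain ⟨i, hi, rfl⟩ := hmem p hp
  have hi := Finset.mem_range.mp hi
  have hmix : mix ∅ id g = g := by funext z; simp [mix]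
  rw [hmix] at hs
  exact (Mergeable.of_iterate hs).mono (by simp only; omega)

end

section

variable {V : Type*}

/-- The first `J` steps of the orbit of `x` under `f` contain a repetition. -/
def EarlyRepeat (f : V → V) (J : ℕ) (x : V) : Prop :=
  ∃ i j, i < j ∧ j ≤ J ∧ f^[i] x = f^[j] x

lemma EarlyRepeat.apply {f : V → V} {J : ℕ} {x : V} (h : EarlyRepeat f J x) :
    EarlyRepeat f J (f x) := by
  obtain ⟨i, j, hij, hj, he⟩ := h
  refine ⟨i, j, hij, hj, ?_⟩
  rw [← Function.iterate_succ_apply, ← Function.iterate_succ_apply,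
    Function.iterate_succ_apply', Function.iterate_succ_apply', he]

lemma injOn_of_not_earlyRepeat {f : V → V} {J : ℕ} {x : V} (h : ¬EarlyRepeat f J x) :
    Set.InjOn (fun i => f^[i] x) (Finset.range J) := by
  intro i hi j hj he
  simp only [Finset.coe_range, Set.mem_Iio] at hi hj
  by_contra hne
  rcases lt_or_gt_of_ne hne with hlt | hlt
  · exact h ⟨i, j, hlt, hj.le, he⟩
  · exact h ⟨j, i, hlt, hi.le, he.symm⟩

variable [Fintype V]

lemma av_earlyRepeat_le (J : ℕ) (x : V) :
    av (fun f : V → V => ind (EarlyRepeat f J x)) ≤ (J : ℝ) ^ 2 / Fintype.card V := by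
  have : Nonempty V := ⟨x⟩
  have h1 : ∀ f : V → V, ind (EarlyRepeat f J x) ≤ ∑ m ∈ Finset.range J,
      ∑ i ∈ Finset.range (m + 1), ind ((∀ i < m, f^[i] x ≠ f^[m] x) ∧ f^[m + 1] x = f^[i] x) := by
    intro f
    refine le_trans (ind_mono (q := ∃ m ∈ Finset.range J, ∃ i ∈ Finset.range (m + 1),
      ((∀ i < m, f^[i] x ≠ f^[m] x) ∧ f^[m + 1] x = f^[i] x)) ?_) ?_
    · rintro ⟨i, j, hij, hj, he⟩
      have hex : ∃ j, ∃ i < j, f^[i] x = f^[j] x := ⟨j, i, hij, he⟩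
      obtain ⟨i₀, hi₀, he₀⟩ := Nat.find_spec hex
      have hle : Nat.find hex ≤ j := Nat.find_min' hex ⟨i, hij, he⟩
      obtain ⟨m, hm⟩ : ∃ m, Nat.find hex = m + 1 := ⟨Nat.find hex - 1, by omega⟩
      rw [hm] at hi₀ he₀
      refine ⟨m, Finset.mem_range.mpr (by omega), i₀, Finset.mem_range.mpr hi₀,
        fun k hk hkm => Nat.find_min hex (m := m) (by omega) ⟨k, hk, hkm⟩, he₀.symm⟩
    · exact (ind_exists_mem_le _ _).trans
        (Finset.sum_le_sum fun m _ => ind_exists_mem_le _ _)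
  refine (av_mono h1).trans ?_
  rw [av_sum]
  simp_rw [av_sum]
  calc _ ≤ ∑ m ∈ Finset.range J, ∑ i ∈ Finset.range J, 1 / (Fintype.card V : ℝ) := by
        refine Finset.sum_le_sum fun m hm => ?_
        have hm' := Finset.mem_range.mp hm
        calc _ ≤ ∑ i ∈ Finset.range (m + 1), 1 / (Fintype.card V : ℝ) := by
              refine Finset.sum_le_sum fun i hi => ?_
              have hi' := Finset.mem_range.mp hi
              refine ((isRandomMap_id (V := V)).av_first_repeat x (by omega)).trans ?_
              exact av_const_le (by positivity)
          _ ≤ _ := by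
              refine Finset.sum_le_sum_of_subset_of_nonneg
                (Finset.range_subset_range.mpr (by omega)) fun _ _ _ => by positivity
    _ = _ := by simp; ring

/-- The centred indicator of a collision of `f` at a pair. -/
noncomputable def collisionDev (f : V → V) (P : V × V) : ℝ :=
  ind (f P.1 = f P.2) - 1 / (Fintype.card V : ℝ)

lemma collisionDev_swap (f : V → V) (P : V × V) : collisionDev f P.swap = collisionDev f P := by
  simp only [collisionDev, Prod.fst_swap, Prod.snd_swap]
  rw [ind_congr (eq_comm (a := f P.2))]

lemma av_collisionDev_mul_eq_zero {P Q : V × V} (hP : P.1 ≠ P.2) (h1 : P.1 ≠ Q.1)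
    (h2 : P.1 ≠ Q.2) : av (fun f : V → V => collisionDev f P * collisionDev f Q) = 0 := by
  have : Nonempty V := ⟨P.1⟩
  rw [av_update P.1]
  have h : ∀ (f : V → V), av (fun y => collisionDev (Function.update f P.1 y) P *
      collisionDev (Function.update f P.1 y) Q) = 0 := by
    intro f
    simp only [collisionDev, Function.update_self, Function.update_of_ne hP.symm,
      Function.update_of_ne h1.symm, Function.update_of_ne h2.symm]
    rw [av_mul_const, av_sub, av_const]
    have : av (fun y => ind (y = f P.2)) = 1 / (Fintype.card V : ℝ) := by
      simp [av, ind]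
    rw [this]; ring
  simp_rw [h]
  exact av_const 0

lemma av_collisionDev_sq_le {P : V × V} (hP : P.1 ≠ P.2) :
    av (fun f : V → V => collisionDev f P * collisionDev f P) ≤ 1 / (Fintype.card V : ℝ) := by
  have : Nonempty V := ⟨P.1⟩
  have hn : (1 : ℝ) ≤ Fintype.card V := by exact_mod_cast Fintype.card_pos
  rw [av_update P.1]
  refine av_le_of_le (by positivity) fun f => ?_
  simp only [collisionDev, Function.update_self, Function.update_of_ne hP.symm]
  have h1 : ∀ y, (ind (y = f P.2) - 1 / (Fintype.card V : ℝ)) *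
      (ind (y = f P.2) - 1 / (Fintype.card V : ℝ)) =
      (1 - 2 / (Fintype.card V : ℝ)) * ind (y = f P.2) + (1 / (Fintype.card V : ℝ)) ^ 2 := by
    intro y
    by_cases hy : y = f P.2
    · rw [ind_of_true hy]; ring
    · rw [ind_of_not hy]; ring
  simp_rw [h1]
  rw [av_add, av_const_mul, av_const]
  have : av (fun y => ind (y = f P.2)) = 1 / (Fintype.card V : ℝ) := by
    simp [av, ind]
  rw [this]
  have h0 : 0 ≤ (1 / (Fintype.card V : ℝ)) ^ 2 := sq_nonneg _
  calc _ = 1 / (Fintype.card V : ℝ) - (1 / (Fintype.card V : ℝ)) ^ 2 := by ring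
    _ ≤ _ := by linarith

lemma av_collisions_le [Nonempty V] :
    av (fun f : V → V => ind (4 * (Fintype.card V : ℝ) < collisions f)) ≤
      1 / (2 * Fintype.card V) := by
  have hn : (1 : ℝ) ≤ Fintype.card V := by exact_mod_cast Fintype.card_pos
  set N : ℝ := (Fintype.card V : ℝ) with hN
  set O : Finset (V × V) := Finset.univ.offDiag with hO
  have hOc : (O.card : ℝ) = N * N - N := by
    rw [hO, Finset.offDiag_card, Finset.card_univ, Nat.cast_sub (Nat.le_mul_self _)]
    push_cast; rfl
  have hT : ∀ f : V → V, collisions f = N + ∑ P ∈ O, ind (f P.1 = f P.2) := by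
    intro f
    have h1 : collisions f = ∑ P : V × V, ind (f P.1 = f P.2) := by
      rw [collisions, Fintype.sum_prod_type]
    rw [h1, ← Finset.univ_product_univ, ← Finset.diag_union_offDiag,
      Finset.sum_union (Finset.disjoint_diag_offDiag _), ← hO]
    congr 1
    rw [Finset.sum_diag]
    simp [ind, hN]
  have hT' : ∀ f : V → V, ∑ P ∈ O, collisionDev f P = collisions f - 2 * N + 1 := by
    intro f
    rw [hT]
    simp only [collisionDev, Finset.sum_sub_distrib, Finset.sum_const, nsmul_eq_mul, hOc, ← hN]
    field_simp
    ring
  have hsq : av (fun f : V → V => (∑ P ∈ O, collisionDev f P) ^ 2) ≤ 2 * N := by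
    simp_rw [sq, Finset.sum_mul_sum]
    rw [av_sum]
    simp_rw [av_sum]
    have hPQ : ∀ P ∈ O, ∀ Q ∈ O, av (fun f : V → V => collisionDev f P * collisionDev f Q) ≤
        1 / N * (ind (P = Q) + ind (P.swap = Q)) := by
      intro P hP Q hQ
      have hP' : P.1 ≠ P.2 := (Finset.mem_offDiag.mp hP).2.2
      have hQ' : Q.1 ≠ Q.2 := (Finset.mem_offDiag.mp hQ).2.2
      have hrhs : 0 ≤ 1 / N * (ind (P = Q) + ind (P.swap = Q)) :=
        mul_nonneg (by positivity) (add_nonneg (ind_nonneg _) (ind_nonneg _))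
      by_cases e1 : P.1 = Q.1 ∨ P.1 = Q.2
      · by_cases e2 : P.2 = Q.1 ∨ P.2 = Q.2
        · have hle := av_collisionDev_sq_le hP'
          rcases e1 with e1 | e1
          · have : P = Q := Prod.ext e1 (e2.resolve_left fun h => hP' (e1.trans h.symm))
            subst this
            rw [ind_of_true rfl]
            refine hle.trans ?_
            rw [← hN]
            nlinarith [ind_nonneg (P.swap = P), show 0 < 1 / N by positivity]
          · have : P.swap = Q := Prod.ext (e2.resolve_right fun h => hP' (e1.trans h.symm)) e1
            subst this
            simp_rw [collisionDev_swap]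
            rw [ind_of_true trivial]
            refine hle.trans ?_
            rw [← hN]
            nlinarith [ind_nonneg (P = P.swap), show 0 < 1 / N by positivity]
        · push Not at e2
          have h0 := av_collisionDev_mul_eq_zero (P := P.swap) (Q := Q) hP'.symm e2.1 e2.2
          simp_rw [collisionDev_swap] at h0
          rw [h0]; exact hrhs
      · push Not at e1
        rw [av_collisionDev_mul_eq_zero hP' e1.1 e1.2]; exact hrhs
    calc _ ≤ ∑ P ∈ O, ∑ Q ∈ O, 1 / N * (ind (P = Q) + ind (P.swap = Q)) :=
          Finset.sum_le_sum fun P hP => Finset.sum_le_sum fun Q hQ => hPQ P hP Q hQ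
      _ ≤ ∑ P ∈ O, ∑ Q, 1 / N * (ind (P = Q) + ind (P.swap = Q)) := by
          refine Finset.sum_le_sum fun P hP => ?_
          refine Finset.sum_le_sum_of_subset_of_nonneg (Finset.subset_univ _) fun Q _ _ => ?_
          exact mul_nonneg (by positivity) (add_nonneg (ind_nonneg _) (ind_nonneg _))
      _ = ∑ P ∈ O, 1 / N * 2 := by
          refine Finset.sum_congr rfl fun P _ => ?_
          rw [← Finset.mul_sum, Finset.sum_add_distrib]
          have hone : ∀ a : V × V, ∑ b, ind (a = b) = 1 := fun a => by
            simpa using sum_ind_mul_of_eq a fun _ => 1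
          rw [hone, hone]
          norm_num
      _ = (N * N - N) * (1 / N * 2) := by rw [Finset.sum_const, nsmul_eq_mul, hOc]
      _ = 2 * N - 2 := by field_simp
      _ ≤ _ := by linarith
  have hmk : av (fun f : V → V => ind (4 * N < collisions f)) ≤
      av (fun f : V → V => ind (4 * N ^ 2 < (∑ P ∈ O, collisionDev f P) ^ 2)) := by
    refine av_mono fun f => ind_mono fun h => ?_
    rw [hT' f]
    nlinarith
  refine hmk.trans ((av_ind_lt_le (fun f => sq_nonneg _) (by positivity)).trans ?_)
  rw [div_le_div_iff₀ (by positivity) (by positivity)]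
  nlinarith

/-- The conditions on one letter making all pairs of states merge quickly, with high probability
over the choice of the other letter. -/
def GoodLetter (f : V → V) (I : ℕ) (κ : ℝ) : Prop :=
  collisions f ≤ 4 * Fintype.card V ∧ ((Finset.univ.image f^[I]).card : ℝ) * κ ≤ 1

lemma av_not_goodLetter_le [Nonempty V] {I : ℕ} {κ : ℝ} (hI : 1 ≤ I) (hκ : 0 < κ) :
    av (fun f : V → V => ind (¬GoodLetter f I κ)) ≤
      1 / (2 * Fintype.card V) + κ * (48 * Fintype.card V / I + 7 * I) := by
  have h1 : ∀ f : V → V, ind (¬GoodLetter f I κ) ≤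
      ind (4 * (Fintype.card V : ℝ) < collisions f) +
        ind (1 / κ < ((Finset.univ.image f^[I]).card : ℝ)) := by
    intro f
    refine le_trans (ind_mono fun h => ?_) (ind_or_le _ _)
    by_contra hc
    push Not at hc
    refine h ⟨hc.1, ?_⟩
    rw [← le_div_iff₀ hκ]
    exact hc.2
  refine (av_mono h1).trans ?_
  rw [av_add]
  refine add_le_add av_collisions_le
    ((av_ind_lt_le (fun f => Nat.cast_nonneg _) (by positivity)).trans ?_)
  rw [div_div_eq_mul_div, div_one, mul_comm]
  exact mul_le_mul_of_nonneg_left ((isRandomMap_id (V := V)).av_card_image_iterate_le hI) hκ.le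

/-- Some pair of states without early repetitions under a good letter is not merged quickly. -/
def PairFailure (f g : V → V) (I M ℓ : ℕ) (κ : ℝ) : Prop :=
  GoodLetter f I κ ∧ ∃ x y, ¬EarlyRepeat f (3 * M) x ∧ ¬EarlyRepeat f (3 * M) y ∧
    ¬Mergeable f g ℓ x y

lemma av_pairFailure_le {I M N R : ℕ} {κ : ℝ}
    (hn : 1000 ≤ Fintype.card V) (hκ0 : 0 < κ) (hκ1 : κ ≤ 1) (hnκ : 100 ≤ κ * Fintype.card V)
    (hR : 1 / 4 ≤ (7 / 5 : ℝ) ^ R * κ) (hMN : 1000 * (2 * M + 4 * N) ≤ Fintype.card V)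
    (f : V → V) :
    av (fun g => ind (PairFailure f g I M (2 * R + 1 + I + 3 * M) κ)) ≤
      (Fintype.card V : ℝ) ^ 2 * ((3 / 4) ^ M + (1 - κ) ^ N) := by
  have hpow : 0 ≤ (1 - κ) ^ N := pow_nonneg (by linarith) _
  by_cases hgood : GoodLetter f I κ
  swap
  · refine av_le_of_le (by positivity) fun g => ?_
    rw [ind_of_not fun h => hgood h.1]
    positivity
  have h1 : ∀ g : V → V, ind (PairFailure f g I M (2 * R + 1 + I + 3 * M) κ) ≤
      ∑ x, ∑ y, ind (¬EarlyRepeat f (3 * M) x ∧ ¬EarlyRepeat f (3 * M) y ∧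
        ¬Mergeable f g (2 * R + 1 + I + 3 * M) x y) := fun g =>
    (ind_mono fun h => h.2).trans ((ind_exists_le _).trans
      (Finset.sum_le_sum fun x _ => ind_exists_le _))
  refine (av_mono h1).trans ?_
  rw [av_sum]
  simp_rw [av_sum]
  calc _ ≤ ∑ x : V, ∑ y : V, ((3 / 4) ^ M + (1 - κ) ^ N) := by
        refine Finset.sum_le_sum fun x _ => Finset.sum_le_sum fun y _ => ?_
        by_cases hxy : ¬EarlyRepeat f (3 * M) x ∧ ¬EarlyRepeat f (3 * M) y
        · refine (av_mono fun g => ind_mono fun h => h.2.2).trans ?_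
          exact av_not_mergeable_le hn hgood.1 hκ0 hgood.2 hnκ hR hMN
            (injOn_of_not_earlyRepeat hxy.1) (injOn_of_not_earlyRepeat hxy.2)
        · refine av_le_of_le (by positivity) fun g => ?_
          rw [ind_of_not fun h => hxy ⟨h.1, h.2.1⟩]
          positivity
    _ = _ := by
        simp only [Finset.sum_const, Finset.card_univ, nsmul_eq_mul]
        ring

lemma av_earlyRepeat_both_le (J : ℕ) :
    av (fun f : V → V => av fun g : V → V =>
      ind (∃ x, EarlyRepeat f J x ∧ EarlyRepeat g J x)) ≤ (J : ℝ) ^ 4 / Fintype.card V := by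
  refine (av_mono fun f => av_mono fun g => ind_exists_le _).trans ?_
  simp_rw [ind_and, av_sum, av_const_mul, av_mul_const]
  calc _ ≤ ∑ x : V, (J : ℝ) ^ 2 / Fintype.card V * ((J : ℝ) ^ 2 / Fintype.card V) := by
        refine Finset.sum_le_sum fun x _ => ?_
        have h := av_earlyRepeat_le J x
        have h0 : 0 ≤ av (fun f : V → V => ind (EarlyRepeat f J x)) :=
          av_nonneg fun _ => ind_nonneg _
        gcongr
    _ = (Fintype.card V : ℝ) * ((J : ℝ) ^ 2 / Fintype.card V * ((J : ℝ) ^ 2 / Fintype.card V)) := by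
        simp
    _ ≤ _ := by
        rcases eq_or_ne (Fintype.card V : ℝ) 0 with h | h
        · simp [h]
        · refine le_of_eq ?_
          field_simp

lemma av_exists_mem_map_mem_le (B : Finset V) :
    av (fun g : V → V => ind (∃ x ∈ B, g x ∈ B)) ≤ B.card / Real.sqrt (Fintype.card V) := by
  rcases isEmpty_or_nonempty V with hV | hV
  · refine av_le_of_le (by positivity) fun g => ?_
    rw [ind_of_not fun ⟨x, _⟩ => hV.false x]
    positivity
  have hn : (0 : ℝ) < Fintype.card V := by exact_mod_cast Fintype.card_pos
  set s := Real.sqrt (Fintype.card V) with hs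
  have hs0 : 0 < s := Real.sqrt_pos.mpr hn
  have hss : s ^ 2 = Fintype.card V := Real.sq_sqrt hn.le
  rw [le_div_iff₀ hs0]
  have h1 : av (fun g : V → V => ind (∃ x ∈ B, g x ∈ B)) ≤ 1 :=
    av_le_of_le zero_le_one fun _ => ind_le_one _
  have h2 : av (fun g : V → V => ind (∃ x ∈ B, g x ∈ B)) ≤ (B.card : ℝ) ^ 2 / s ^ 2 := by
    refine (av_mono fun g => ind_exists_mem_le _ _).trans ?_
    rw [av_sum]
    calc _ ≤ ∑ x ∈ B, (B.card : ℝ) / s ^ 2 := by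
          refine Finset.sum_le_sum fun x _ => ?_
          rw [av_update x]
          refine av_le_of_le (by positivity) fun g => ?_
          simp only [Function.update_self]
          rw [av, sum_ind, hss]
          refine le_of_eq ?_
          congr 3
          ext y; simp
      _ = _ := by rw [Finset.sum_const, nsmul_eq_mul]; ring
  rcases le_total s B.card with h | h
  · nlinarith
  · refine le_trans (mul_le_mul_of_nonneg_right h2 hs0.le) ?_
    have : (B.card : ℝ) ^ 2 / s ^ 2 * s = B.card * (B.card / s) := by field_simp
    rw [this]
    have h3 : (B.card : ℝ) / s ≤ 1 := (div_le_one hs0).mpr h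
    have : (0 : ℝ) ≤ B.card := Nat.cast_nonneg _
    nlinarith

lemma av_earlyRepeat_apply_le (J : ℕ) :
    av (fun f : V → V => av fun g : V → V =>
      ind (∃ x, EarlyRepeat f J x ∧ EarlyRepeat f J (g x))) ≤
      (J : ℝ) ^ 2 / Real.sqrt (Fintype.card V) := by
  have h1 : ∀ f : V → V, av (fun g : V → V =>
      ind (∃ x, EarlyRepeat f J x ∧ EarlyRepeat f J (g x))) ≤
      (∑ x, ind (EarlyRepeat f J x)) * (Real.sqrt (Fintype.card V))⁻¹ := by
    intro f
    have h := av_exists_mem_map_mem_le (Finset.univ.filter (EarlyRepeat f J))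
    rw [sum_ind, ← div_eq_mul_inv]
    simpa using h
  refine (av_mono h1).trans ?_
  rw [av_mul_const, av_sum, div_eq_mul_inv]
  refine mul_le_mul_of_nonneg_right ?_ (by positivity)
  calc _ ≤ ∑ x : V, (J : ℝ) ^ 2 / Fintype.card V :=
        Finset.sum_le_sum fun x _ => av_earlyRepeat_le J x
    _ = (Fintype.card V : ℝ) * ((J : ℝ) ^ 2 / Fintype.card V) := by simp
    _ ≤ _ := by
        rcases eq_or_ne (Fintype.card V : ℝ) 0 with h | h
        · rw [h]; simp
        · refine le_of_eq ?_
          field_simp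

lemma forall_mergeable {f g : V → V} {I M ℓ : ℕ} {κ : ℝ}
    (hf : GoodLetter f I κ) (hg : GoodLetter g I κ)
    (hfg : ¬PairFailure f g I M ℓ κ) (hgf : ¬PairFailure g f I M ℓ κ)
    (hboth : ¬∃ x, EarlyRepeat f (3 * M) x ∧ EarlyRepeat g (3 * M) x)
    (happ : ¬∃ x, EarlyRepeat f (3 * M) x ∧ EarlyRepeat f (3 * M) (g x)) (x y : V) :
    Mergeable f g (ℓ + 1) x y := by
  have hF : ∀ x y, ¬EarlyRepeat f (3 * M) x → ¬EarlyRepeat f (3 * M) y → Mergeable f g ℓ x y := by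
    intro x y hx hy
    by_contra h
    exact hfg ⟨hf, x, y, hx, hy, h⟩
  have hG : ∀ x y, ¬EarlyRepeat g (3 * M) x → ¬EarlyRepeat g (3 * M) y → Mergeable f g ℓ x y := by
    intro x y hx hy
    by_contra h
    exact hgf ⟨hg, x, y, hx, hy, fun hm => h hm.swap⟩
  have hmixed : ∀ x y, EarlyRepeat f (3 * M) x → EarlyRepeat g (3 * M) y →
      Mergeable f g (ℓ + 1) x y := fun x y hx hy =>
    (hF (g x) (g y) (fun h => happ ⟨x, hx, h⟩) fun h => hboth ⟨g y, h, hy.apply⟩).cons_true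
  push Not at hboth
  by_cases hxf : EarlyRepeat f (3 * M) x
  · by_cases hyg : EarlyRepeat g (3 * M) y
    · exact hmixed x y hxf hyg
    · exact (hG x y (hboth x hxf) hyg).mono (by omega)
  · by_cases hyf : EarlyRepeat f (3 * M) y
    · by_cases hxg : EarlyRepeat g (3 * M) x
      · exact (hmixed y x hyf hxg).symm
      · exact (hG x y hxg (hboth y hyf)).mono (by omega)
    · exact (hF x y hxf hyf).mono (by omega)

lemma av_not_forall_mergeable_le {I M N R : ℕ} {κ : ℝ} (hI : 1 ≤ I)
    (hn : 1000 ≤ Fintype.card V) (hκ0 : 0 < κ) (hκ1 : κ ≤ 1) (hnκ : 100 ≤ κ * Fintype.card V)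
    (hR : 1 / 4 ≤ (7 / 5 : ℝ) ^ R * κ) (hMN : 1000 * (2 * M + 4 * N) ≤ Fintype.card V) :
    av (fun f : V → V => av fun g : V → V =>
      ind (¬∀ x y, Mergeable f g (2 * R + 1 + I + 3 * M + 1) x y)) ≤
      2 * (1 / (2 * Fintype.card V) + κ * (48 * Fintype.card V / I + 7 * I)) +
      2 * ((Fintype.card V : ℝ) ^ 2 * ((3 / 4) ^ M + (1 - κ) ^ N)) +
      ((3 * M : ℕ) : ℝ) ^ 4 / Fintype.card V +
      ((3 * M : ℕ) : ℝ) ^ 2 / Real.sqrt (Fintype.card V) := by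
  have : Nonempty V := Fintype.card_pos_iff.mp (by omega)
  set ℓ := 2 * R + 1 + I + 3 * M with hℓ
  have hpt : ∀ f g : V → V, ind (¬∀ x y, Mergeable f g (ℓ + 1) x y) ≤
      ind (¬GoodLetter f I κ) + (ind (¬GoodLetter g I κ) + (ind (PairFailure f g I M ℓ κ) +
      (ind (PairFailure g f I M ℓ κ) +
      (ind (∃ x, EarlyRepeat f (3 * M) x ∧ EarlyRepeat g (3 * M) x) +
      ind (∃ x, EarlyRepeat f (3 * M) x ∧ EarlyRepeat f (3 * M) (g x)))))) := by
    intro f g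
    have h : ¬(∀ x y, Mergeable f g (ℓ + 1) x y) → ¬GoodLetter f I κ ∨ ¬GoodLetter g I κ ∨
        PairFailure f g I M ℓ κ ∨ PairFailure g f I M ℓ κ ∨
        (∃ x, EarlyRepeat f (3 * M) x ∧ EarlyRepeat g (3 * M) x) ∨
        ∃ x, EarlyRepeat f (3 * M) x ∧ EarlyRepeat f (3 * M) (g x) := by
      intro h
      by_contra hc
      simp only [not_or, not_not] at hc
      exact h (forall_mergeable hc.1 hc.2.1 hc.2.2.1 hc.2.2.2.1 hc.2.2.2.2.1 hc.2.2.2.2.2)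
    refine (ind_mono h).trans ((ind_or_le _ _).trans ?_)
    gcongr
    refine (ind_or_le _ _).trans ?_
    gcongr
    refine (ind_or_le _ _).trans ?_
    gcongr
    refine (ind_or_le _ _).trans ?_
    gcongr
    exact ind_or_le _ _
  refine (av_mono fun f => av_mono fun g => hpt f g).trans ?_
  simp_rw [av_add, av_const]
  have h1 := av_not_goodLetter_le (V := V) hI hκ0
  have h2 : av (fun f : V → V => av fun g : V → V => ind (PairFailure f g I M ℓ κ)) ≤
      (Fintype.card V : ℝ) ^ 2 * ((3 / 4) ^ M + (1 - κ) ^ N) := by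
    refine (av_mono fun f => av_pairFailure_le hn hκ0 hκ1 hnκ hR hMN f).trans (le_of_eq ?_)
    exact av_const _
  have h3 : av (fun f : V → V => av fun g : V → V => ind (PairFailure g f I M ℓ κ)) ≤
      (Fintype.card V : ℝ) ^ 2 * ((3 / 4) ^ M + (1 - κ) ^ N) := by
    rw [av_comm]
    exact h2
  have h4 := av_earlyRepeat_both_le (V := V) (3 * M)
  have h5 := av_earlyRepeat_apply_le (V := V) (3 * M)
  linarith

end

section

lemma eventually_mul_log_pow_le (c : ℝ) :
    ∃ n₀ : ℕ, ∀ n : ℕ, n₀ ≤ n → c * Real.log n ^ 4 ≤ Real.sqrt n ∧ 1 ≤ Real.log n := by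
  have h1 := (isLittleO_log_rpow_rpow_atTop (s := 1 / 2) 4 (by norm_num)).bound
    (c := (|c| + 1)⁻¹) (by positivity)
  have h2 := tendsto_natCast_atTop_atTop.eventually (h1.and
    ((Real.tendsto_log_atTop.eventually_ge_atTop 1).and (Filter.eventually_ge_atTop (1 : ℝ))))
  obtain ⟨n₀, hn₀⟩ := Filter.eventually_atTop.mp h2
  refine ⟨n₀, fun n hn => ?_⟩
  obtain ⟨h, hl, h1⟩ := hn₀ n hn
  refine ⟨?_, hl⟩
  have e1 : Real.log n ^ (4 : ℝ) = Real.log n ^ 4 := by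
    exact_mod_cast Real.rpow_natCast (Real.log n) 4
  rw [e1, ← Real.sqrt_eq_rpow, Real.norm_of_nonneg (by positivity),
    Real.norm_of_nonneg (Real.sqrt_nonneg _), inv_mul_eq_div, le_div_iff₀ (by positivity)] at h
  have h4 : 0 ≤ Real.log n ^ 4 := by positivity
  nlinarith [le_abs_self c]

lemma exp_neg_three_mul_log {x : ℝ} (hx : 0 < x) : Real.exp (-(3 * Real.log x)) = (x ^ 3)⁻¹ := by
  rw [Real.exp_neg, mul_comm, Real.exp_mul, Real.exp_log hx]
  norm_cast

lemma three_quarters_pow_le {x : ℝ} (hx : 0 < x) {M : ℕ} (hM : 12 * Real.log x ≤ M) :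
    (3 / 4 : ℝ) ^ M ≤ (x ^ 3)⁻¹ := by
  rw [← exp_neg_three_mul_log hx]
  calc (3 / 4 : ℝ) ^ M ≤ Real.exp (-(1 / 4)) ^ M := by
        gcongr
        linarith [Real.one_sub_le_exp_neg (1 / 4)]
    _ = Real.exp (M * -(1 / 4)) := by rw [Real.exp_nat_mul]
    _ ≤ _ := by
        apply Real.exp_le_exp.mpr
        linarith

lemma one_sub_pow_le {x κ : ℝ} (hx : 0 < x) (hκ : κ ≤ 1) {N : ℕ}
    (hN : 3 * Real.log x ≤ N * κ) : (1 - κ) ^ N ≤ (x ^ 3)⁻¹ := by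
  rw [← exp_neg_three_mul_log hx]
  calc (1 - κ) ^ N ≤ Real.exp (-κ) ^ N :=
        pow_le_pow_left₀ (by linarith) (Real.one_sub_le_exp_neg κ) N
    _ = Real.exp (N * -κ) := by rw [Real.exp_nat_mul]
    _ ≤ _ := by
        apply Real.exp_le_exp.mpr
        linarith

lemma natLog_le_two_mul_log {n : ℕ} (hn : 1 ≤ n) : (Nat.log 2 n : ℝ) ≤ 2 * Real.log n := by
  have h1 : (2 : ℝ) ^ Nat.log 2 n ≤ n := by exact_mod_cast Nat.pow_log_le_self 2 (by omega)
  have h2 := Real.log_le_log (by positivity) h1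
  rw [Real.log_pow] at h2
  have h3 := Real.log_two_gt_d9
  have h4 : (0 : ℝ) ≤ Nat.log 2 n := Nat.cast_nonneg _
  nlinarith

lemma natCast_le_pow_natLog (n : ℕ) : (n : ℝ) ≤ (7 / 5 : ℝ) ^ (3 * (Nat.log 2 n + 1)) := by
  have h1 : (n : ℝ) ≤ (2 : ℝ) ^ (Nat.log 2 n + 1) := by
    exact_mod_cast (Nat.lt_pow_succ_log_self (by norm_num) n).le
  refine h1.trans ?_
  rw [pow_mul]
  gcongr
  norm_num

set_option maxHeartbeats 1000000 in
/-- With high probability all pairs of states are merged by words of length `O(ε⁻¹ log n)`. -/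
lemma exists_av_not_forall_mergeable_le {ε : ℝ} (hε : 0 < ε) (hε1 : ε ≤ 1) :
    ∃ n₀ : ℕ, ∀ (V : Type) [Fintype V] (n : ℕ), Fintype.card V = n → n₀ ≤ n →
      ∃ ℓ : ℕ, (ℓ : ℝ) ≤ 7000000 * ε⁻¹ * Real.log n ∧
      av (fun f : V → V => av fun g : V → V =>
        ind (¬∀ x y, Mergeable f g ℓ x y)) ≤ 3 / 4 * ε := by
  set c : ℝ := 1 + 14 * 18000 * 6912001 * ε⁻¹ + 4 + 39 ^ 4 + 39 ^ 2 with hc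
  have hε' : 1 ≤ ε⁻¹ := (one_le_inv₀ hε).mpr hε1
  have hc0 : 0 < c := by positivity
  obtain ⟨n₀, hn₀⟩ := eventually_mul_log_pow_le (1000000 + 2 * c * ε⁻¹)
  refine ⟨max n₀ 1, fun V _ n hV hn => ?_⟩
  obtain ⟨hlog, hl⟩ := hn₀ n (le_trans (le_max_left _ _) hn)
  have hn1 : 1 ≤ n := le_trans (le_max_right _ _) hn
  set l := Real.log n with hldef
  set s := Real.sqrt n with hsdef
  have hss : s ^ 2 = n := Real.sq_sqrt (Nat.cast_nonneg n)
  have hl4 : 1 ≤ l ^ 4 := one_le_pow₀ hl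
  have hll4 : l ≤ l ^ 4 := le_self_pow₀ hl (by norm_num)
  have hl24 : l ^ 2 ≤ l ^ 4 := pow_le_pow_right₀ hl (by norm_num)
  have hs1 : 1000000 * l ^ 4 ≤ s := by
    have : 0 ≤ 2 * c * ε⁻¹ * l ^ 4 := by positivity
    linarith
  have hs2 : c * (l ^ 4 / s) ≤ ε / 2 := by
    have hspos : 0 < s := by linarith
    have h1 : 2 * c * ε⁻¹ * l ^ 4 ≤ s := by
      have : 0 ≤ 1000000 * l ^ 4 := by positivity
      linarith
    rw [mul_div_assoc', div_le_iff₀ hspos]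
    have h2 : ε / 2 * (2 * c * ε⁻¹ * l ^ 4) ≤ ε / 2 * s := by gcongr
    have h3 : ε / 2 * (2 * c * ε⁻¹ * l ^ 4) = c * l ^ 4 := by field_simp
    linarith
  have hspos : 1000000 ≤ s := by linarith
  have hns : 1000000 * s ≤ n := by rw [← hss]; nlinarith
  have hnbig : (1000000 : ℝ) ≤ n := by linarith
  have hnpos : (0 : ℝ) < n := by linarith
  have hln : 1000000 * l ≤ n := by nlinarith
  set I := ⌈6912000 * ε⁻¹ * l⌉₊ with hI
  set M := ⌈12 * l⌉₊ with hM
  set R := 3 * (Nat.log 2 n + 1) with hR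
  set N := n / 5000 with hN
  set κ : ℝ := 18000 * l / n with hκ
  have hIge : 6912000 * ε⁻¹ * l ≤ I := Nat.le_ceil _
  have hIle : (I : ℝ) ≤ 6912001 * ε⁻¹ * l := by
    have h1 : (I : ℝ) < 6912000 * ε⁻¹ * l + 1 := Nat.ceil_lt_add_one (by positivity)
    have h2 : 1 ≤ ε⁻¹ * l := one_le_mul_of_one_le_of_one_le hε' hl
    nlinarith
  have hMge : 12 * l ≤ M := Nat.le_ceil _
  have hMle : (M : ℝ) ≤ 13 * l := by
    have h1 : (M : ℝ) < 12 * l + 1 := Nat.ceil_lt_add_one (by positivity)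
    linarith
  have hRle : (R : ℝ) ≤ 9 * l := by
    have := natLog_le_two_mul_log hn1
    rw [hR]; push_cast; linarith
  have hIpos : (0 : ℝ) < I := lt_of_lt_of_le (by positivity) hIge
  have hκn : κ * n = 18000 * l := by rw [hκ]; field_simp
  have hκ0 : 0 < κ := by positivity
  have hκ1 : κ ≤ 1 := by rw [hκ, div_le_one hnpos]; linarith
  have hNle : 5000 * (N : ℝ) ≤ n := by exact_mod_cast Nat.mul_div_le n 5000
  have hNge : (n : ℝ) ≤ 5000 * N + 5000 := by
    have : n ≤ 5000 * N + 5000 := by omega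
    exact_mod_cast this
  have hmain := av_not_forall_mergeable_le (V := V) (I := I) (M := M) (N := N) (R := R)
    (κ := κ) (by exact_mod_cast hIpos) (by
      rw [hV]
      have : (1000 : ℝ) ≤ n := by linarith
      exact_mod_cast this) hκ0 hκ1 (by rw [hV, hκn]; linarith) (by
      have h1 := natCast_le_pow_natLog n
      have h2 : (n : ℝ) * κ ≤ (7 / 5 : ℝ) ^ R * κ := by gcongr
      linarith) (by
      rw [hV]
      have : (1000 : ℝ) * (2 * M + 4 * N) ≤ n := by linarith
      exact_mod_cast this)
  refine ⟨2 * R + 1 + I + 3 * M + 1, ?_, hmain.trans ?_⟩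
  · push_cast
    have h1 : l ≤ ε⁻¹ * l := le_mul_of_one_le_left (by linarith) hε'
    nlinarith
  rw [hV, ← hsdef]
  have t1 : κ * (48 * n / I) ≤ ε / 8 := by
    rw [mul_div_assoc', div_le_iff₀ hIpos]
    have h1 : ε / 8 * (6912000 * ε⁻¹ * l) ≤ ε / 8 * I := by gcongr
    have h2 : ε / 8 * (6912000 * ε⁻¹ * l) = 48 * (18000 * l) := by field_simp; norm_num
    nlinarith
  have hinv : 1 / (n : ℝ) ≤ 1 / s := by
    apply one_div_le_one_div_of_le (by linarith); linarith
  have hs0 : 0 < s := by linarith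
  have t0 : 1 / (n : ℝ) ≤ l ^ 4 / s := hinv.trans (by gcongr)
  have t2 : κ * (7 * I) ≤ 7 * 18000 * 6912001 * ε⁻¹ * (l ^ 4 / s) := by
    calc κ * (7 * I) ≤ κ * (7 * (6912001 * ε⁻¹ * l)) := by gcongr
      _ = 7 * 18000 * 6912001 * ε⁻¹ * (l ^ 2 * (1 / n)) := by rw [hκ]; ring
      _ ≤ 7 * 18000 * 6912001 * ε⁻¹ * (l ^ 4 * (1 / s)) := by gcongr
      _ = _ := by ring
  have t3 : (n : ℝ) ^ 2 * ((3 / 4) ^ M + (1 - κ) ^ N) ≤ 2 * (l ^ 4 / s) := by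
    have h1 := three_quarters_pow_le hnpos hMge
    have h2 := one_sub_pow_le (N := N) hnpos hκ1 (by
      have h3 : ((n : ℝ) - 5000) * κ ≤ 5000 * N * κ := by
        apply mul_le_mul_of_nonneg_right _ hκ0.le; linarith
      have h4 : (n - 5000) * κ = 18000 * l - 5000 * κ := by rw [← hκn]; ring
      nlinarith)
    calc _ ≤ (n : ℝ) ^ 2 * (((n : ℝ) ^ 3)⁻¹ + ((n : ℝ) ^ 3)⁻¹) := by gcongr
      _ = 2 * (1 / n) := by field_simp; norm_num
      _ ≤ _ := by gcongr
  have t4 : ((3 * M : ℕ) : ℝ) ^ 4 / n ≤ 39 ^ 4 * (l ^ 4 / s) := by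
    have h1 : ((3 * M : ℕ) : ℝ) ≤ 39 * l := by push_cast; linarith
    calc _ ≤ (39 * l) ^ 4 / s := by
          gcongr
          linarith
      _ = _ := by ring
  have t5 : ((3 * M : ℕ) : ℝ) ^ 2 / s ≤ 39 ^ 2 * (l ^ 4 / s) := by
    have h1 : ((3 * M : ℕ) : ℝ) ≤ 39 * l := by push_cast; linarith
    calc _ ≤ (39 * l) ^ 2 / s := by gcongr
      _ = 39 ^ 2 * (l ^ 2 / s) := by ring
      _ ≤ _ := by gcongr
  have t6 : 2 * (1 / (2 * (n : ℝ)) + κ * (48 * n / I + 7 * I)) =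
      1 / n + 2 * (κ * (48 * n / I)) + 2 * (κ * (7 * I)) := by
    field_simp; ring
  rw [t6]
  rw [hc] at hs2
  linarith

/-- With high probability the contracting word has a small image. -/
lemma exists_av_lt_card_image_le {ε : ℝ} (hε : 0 < ε) (hε1 : ε ≤ 1) :
    ∃ n₀ : ℕ, ∀ (V : Type) [Fintype V] (n : ℕ), Fintype.card V = n → n₀ ≤ n →
      ∃ w : List Bool,
      (w.length : ℝ) ≤ 8 * ε⁻¹ * (Real.sqrt n * Real.sqrt (Real.log n)) ∧
      av (fun f : V → V => av fun g : V → V =>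
        ind (12000 * (Real.sqrt n / Real.sqrt (Real.log n)) <
          ((Finset.univ.image (act f g w)).card : ℝ))) ≤ ε / 4 := by
  have hε' : 1 ≤ ε⁻¹ := (one_le_inv₀ hε).mpr hε1
  obtain ⟨n₀, hn₀⟩ := eventually_mul_log_pow_le (ε⁻¹ ^ 2)
  refine ⟨max n₀ 1, fun V _ n hV hn => ?_⟩
  obtain ⟨hlog, hl⟩ := hn₀ n (le_trans (le_max_left _ _) hn)
  have hn1 : 1 ≤ n := le_trans (le_max_right _ _) hn
  have : Nonempty V := Fintype.card_pos_iff.mp (by omega)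
  set l := Real.log n with hldef
  set s := Real.sqrt n with hsdef
  set q := Real.sqrt l with hqdef
  have hss : s ^ 2 = n := Real.sq_sqrt (Nat.cast_nonneg n)
  have hqq : q ^ 2 = l := Real.sq_sqrt (by linarith)
  have hq1 : 1 ≤ q := Real.one_le_sqrt.mpr hl
  have hs1 : 1 ≤ s := Real.one_le_sqrt.mpr (by exact_mod_cast hn1)
  have hll4 : l ≤ l ^ 4 := le_self_pow₀ hl (by norm_num)
  have hls : ε⁻¹ ^ 2 * q ^ 2 ≤ s := by
    rw [hqq]
    refine le_trans ?_ hlog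
    gcongr
  set K := ⌈s⌉₊ with hK
  set r := ⌈ε⁻¹ * q⌉₊ with hr
  have hKge : s ≤ K := Nat.le_ceil _
  have hKle : (K : ℝ) ≤ s + 1 := (Nat.ceil_lt_add_one (by linarith)).le
  have hrge : ε⁻¹ * q ≤ r := Nat.le_ceil _
  have hεq : 1 ≤ ε⁻¹ * q := one_le_mul_of_one_le_of_one_le hε' hq1
  have hrle : (r : ℝ) ≤ 2 * (ε⁻¹ * q) := by
    have : (r : ℝ) < ε⁻¹ * q + 1 := Nat.ceil_lt_add_one (by positivity)
    linarith
  have hKpos : (0 : ℝ) < K := by linarith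
  have hrpos : (0 : ℝ) < r := by linarith
  refine ⟨contractingWord K r, ?_, ?_⟩
  · rw [length_contractingWord]
    push_cast
    have h1 : (r : ℝ) * (K + 1) ≤ 2 * (ε⁻¹ * q) * (3 * s) := by gcongr; linarith
    have h2 : s ≤ ε⁻¹ * q * s := le_mul_of_one_le_left (by linarith) hεq
    nlinarith
  have hexp := av_card_image_contractingWord_le (V := V) (K := K) (r := r)
    (by exact_mod_cast hKpos) (by exact_mod_cast hrpos)
  rw [hV] at hexp
  have hbound : 48 * (48 * (n : ℝ) / K + 7 * K) / r + 7 * r ≤ 3000 * ε * (s / q) := by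
    have h1 : 48 * (n : ℝ) / K ≤ 48 * s := by
      rw [div_le_iff₀ hKpos, ← hss]
      nlinarith
    have h2 : 48 * (48 * (n : ℝ) / K + 7 * K) / r ≤ 2976 * ε * (s / q) := by
      calc _ ≤ 48 * (48 * s + 7 * (2 * s)) / (ε⁻¹ * q) := by
            gcongr
            linarith
        _ = _ := by field_simp; norm_num
    have h3 : 7 * (r : ℝ) ≤ 14 * ε * (s / q) := by
      have h4 : ε⁻¹ * q ≤ ε * (s / q) := by
        rw [mul_div_assoc', le_div_iff₀ (by linarith)]
        have h5 : ε * (ε⁻¹ ^ 2 * q ^ 2) ≤ ε * s := by gcongr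
        have h6 : ε * (ε⁻¹ ^ 2 * q ^ 2) = ε⁻¹ * q * q := by field_simp
        linarith
      linarith
    have : 0 ≤ ε * (s / q) := by positivity
    linarith
  have hT : 0 < 12000 * (s / q) := by positivity
  refine (av_mono fun f => av_ind_lt_le (fun g => Nat.cast_nonneg _) hT).trans ?_
  simp_rw [div_eq_mul_inv _ (12000 * (s / q))]
  rw [av_mul_const, ← div_eq_mul_inv, div_le_iff₀ hT]
  refine (hexp.trans hbound).trans (le_of_eq ?_)
  ring

/-- Pairs of self-maps correspond to automata over a two-letter alphabet. -/
def automatonEquiv (V : Type*) : (V × Bool → V) ≃ (V → V) × (V → V) where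
  toFun δ := (fun x => δ (x, false), fun x => δ (x, true))
  invFun p := fun z => if z.2 then p.2 z.1 else p.1 z.1
  left_inv δ := by funext ⟨x, c⟩; cases c <;> rfl
  right_inv p := rfl

/-- The synchronization bound for automata on an arbitrary finite set of states. -/
lemma exists_le_av_synchronizing {ε : ℝ} (hε : 0 < ε) (hε1 : ε ≤ 1) :
    ∃ n₀ : ℕ, ∀ (V : Type) [Fintype V] (n : ℕ), Fintype.card V = n → n₀ ≤ n →
      1 - ε ≤ av (fun δ : V × Bool → V => ind (∃ ω : List Bool,
        (ω.length : ℝ) ≤ (8 + 12000 * 7000000) * ε⁻¹ * Real.sqrt (n * Real.log n) ∧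
          (Finset.univ.image (act (automatonEquiv V δ).1 (automatonEquiv V δ).2 ω)).card = 1)) := by
  obtain ⟨n₁, h₁⟩ := exists_av_not_forall_mergeable_le hε hε1
  obtain ⟨n₂, h₂⟩ := exists_av_lt_card_image_le hε hε1
  refine ⟨max (max n₁ n₂) 2, fun V _ n hV hn => ?_⟩
  obtain ⟨ℓ, hℓ, hpairs⟩ := h₁ V n hV (by omega)
  obtain ⟨w, hw, himage⟩ := h₂ V n hV (by omega)
  have hn2 : 2 ≤ n := by omega
  have : Nonempty V := Fintype.card_pos_iff.mp (by omega)
  have hlpos : 0 < Real.log n := Real.log_pos (by exact_mod_cast (by omega : 1 < n))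
  set C : ℝ := 8 + 12000 * 7000000 with hC
  set B : ℝ := C * ε⁻¹ * Real.sqrt (n * Real.log n) with hB
  rw [av_equiv (automatonEquiv V) (fun p => ind (∃ ω : List Bool, (ω.length : ℝ) ≤ B ∧
    (Finset.univ.image (act p.1 p.2 ω)).card = 1)), av_prod]
  have hpt : ∀ f g : V → V,
      1 - (ind (¬∀ x y, Mergeable f g ℓ x y) +
        ind (12000 * (Real.sqrt n / Real.sqrt (Real.log n)) <
          ((Finset.univ.image (act f g w)).card : ℝ))) ≤
      ind (∃ ω : List Bool, (ω.length : ℝ) ≤ B ∧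
        (Finset.univ.image (act f g ω)).card = 1) := by
    intro f g
    by_cases hm : ∀ x y, Mergeable f g ℓ x y
    swap
    · rw [ind_of_true hm]
      linarith [ind_nonneg (12000 * (Real.sqrt n / Real.sqrt (Real.log n)) <
          ((Finset.univ.image (act f g w)).card : ℝ)), ind_nonneg (∃ ω : List Bool,
            (ω.length : ℝ) ≤ B ∧ (Finset.univ.image (act f g ω)).card = 1)]
    by_cases hs : 12000 * (Real.sqrt n / Real.sqrt (Real.log n)) <
          ((Finset.univ.image (act f g w)).card : ℝ)
    · rw [ind_of_true hs]
      linarith [ind_nonneg (¬∀ x y, Mergeable f g ℓ x y), ind_nonneg (∃ ω : List Bool,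
            (ω.length : ℝ) ≤ B ∧ (Finset.univ.image (act f g ω)).card = 1)]
    obtain ⟨w', hw', hc⟩ := exists_word_card_image_eq_one hm (Finset.univ.image (act f g w))
      (Finset.univ_nonempty.image _)
    have hex : ∃ ω : List Bool, (ω.length : ℝ) ≤ B ∧
        (Finset.univ.image (act f g ω)).card = 1 := by
      refine ⟨w ++ w', ?_, ?_⟩
      · have hw'' : (w'.length : ℝ) ≤ ((Finset.univ.image (act f g w)).card : ℝ) * ℓ := by
          exact_mod_cast hw'
        have hq : 0 < Real.sqrt (Real.log n) := Real.sqrt_pos.mpr hlpos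
        have hqq : Real.log n = Real.sqrt (Real.log n) * Real.sqrt (Real.log n) :=
          (Real.mul_self_sqrt hlpos.le).symm
        have h3 : (w'.length : ℝ) ≤ 12000 * (Real.sqrt n / Real.sqrt (Real.log n)) *
            (7000000 * ε⁻¹ * Real.log n) :=
          hw''.trans (mul_le_mul (not_lt.mp hs) hℓ (Nat.cast_nonneg _) (by positivity))
        have h4 : 12000 * (Real.sqrt n / Real.sqrt (Real.log n)) *
            (7000000 * ε⁻¹ * Real.log n) =
            12000 * 7000000 * ε⁻¹ * (Real.sqrt n * Real.sqrt (Real.log n)) := by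
          nth_rewrite 2 [hqq]
          field_simp
        rw [List.length_append, Nat.cast_add, hB, Real.sqrt_mul (Nat.cast_nonneg n), hC]
        linarith
      · rw [← hc, Finset.image_image]
        congr 2
        funext z
        exact act_append f g w w' z
    rw [ind_of_true hex]
    linarith [ind_nonneg (¬∀ x y, Mergeable f g ℓ x y), ind_nonneg (12000 *
      (Real.sqrt n / Real.sqrt (Real.log n)) < ((Finset.univ.image (act f g w)).card : ℝ))]
  refine le_trans ?_ (av_mono fun f => av_mono fun g => hpt f g)
  simp_rw [av_sub, av_add, av_const]
  linarith

lemma run_eq_act {n : ℕ} (δ : Fin n × Bool → Fin n) (w : List Bool) :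
    run δ w = act (automatonEquiv _ δ).1 (automatonEquiv _ δ).2 w := by
  funext x
  induction w generalizing x with
  | nil => rfl
  | cons c w ih => cases c <;> exact ih _

end

end RandomAutomaton

/-- There is a universal constant `C > 0` such that for every
`0 < ε ≤ 1`, for all sufficiently large `n`, a uniformly random automaton has
a synchronizing word of length at most `C·ε⁻¹·√(n ln n)` with probability at
least `1 - ε`. -/
theorem short_synchronizing_word_prob :
    ∃ C : ℝ, 0 < C ∧ ∀ ε : ℝ, 0 < ε → ε ≤ 1 → ∃ n₀ : ℕ, ∀ n : ℕ, n₀ ≤ n →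
      1 - ε ≤
        ((Finset.univ.filter (fun δ : Fin n × Bool → Fin n =>
            ∃ ω : List Bool,
              (ω.length : ℝ) ≤ C * ε⁻¹ * Real.sqrt (n * Real.log n) ∧
                (Finset.univ.image (run δ ω)).card = 1)).card : ℝ)
          / (n : ℝ) ^ (2 * n) := by
  refine ⟨8 + 12000 * 7000000, by norm_num, fun ε hε hε1 => ?_⟩
  obtain ⟨n₀, h⟩ := RandomAutomaton.exists_le_av_synchronizing hε hε1
  refine ⟨n₀, fun n hn => ?_⟩
  have hcard : (n : ℝ) ^ (2 * n) = Fintype.card (Fin n × Bool → Fin n) := by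
    simp [mul_comm]
  rw [hcard, ← RandomAutomaton.av_ind_eq]
  simp_rw [RandomAutomaton.run_eq_act]
  convert h (Fin n) n (Fintype.card_fin n) hn
end

section
/- There exists a sequence ε : ℕ → ℝ with ε(n) → 0 as n → ∞ such that for every n ≥ 1 and every probability vector (p_v)_{v ∈ Fin n} (nonnegative reals summing to 1), if f : Fin n → Fin n is a random function whose values f(v) are independent and each distributed according to (p_v), then the expected number of cyclic vertices of f is at most (1+ε(n))·√(2πn). -/
open scoped BigOperators Classical

section DistinctSamples

variable {V : Type*}

lemma prod_le_prod_swap {p : V → ℝ} (hp : ∀ v, 0 ≤ p v) {k : ℕ} {s : Fin k → V}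
    (hs : Function.Injective s) {u v : V} (huv : p v ≤ p u) (hv : v ∈ Set.range s) :
    ∏ i, p (s i) ≤ ∏ i, p (Equiv.swap u v (s i)) := by
  by_cases hu : u ∈ Set.range s
  · obtain ⟨i, rfl⟩ := hv
    obtain ⟨j, rfl⟩ := hu
    simp_rw [hs.swap_apply]
    exact (Equiv.prod_comp (Equiv.swap j i) fun l => p (s l)).ge
  · refine Finset.prod_le_prod (fun i _ => hp _) fun i _ => ?_
    have hne : s i ≠ u := fun h => hu ⟨i, h⟩
    by_cases h : s i = v
    · rw [h, Equiv.swap_apply_right]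
      exact huv
    · rw [Equiv.swap_apply_of_ne_of_ne hne h]

variable [Fintype V]

/-- The weight of the injective words of length `k`: when `p` is a probability vector, this is the
probability that `k` independent samples from `p` are distinct. -/
noncomputable def distinctWeight (p : V → ℝ) (k : ℕ) : ℝ :=
  ∑ s : Fin k → V with Function.Injective s, ∏ i, p (s i)

/-- The weight of the injective words of length `k` in which the letter `v` occurs. -/
noncomputable def distinctWeightThrough (p : V → ℝ) (k : ℕ) (v : V) : ℝ :=
  ∑ s : Fin k → V with Function.Injective s ∧ v ∈ Set.range s, ∏ i, p (s i)

lemma distinctWeight_nonneg {p : V → ℝ} (hp : ∀ v, 0 ≤ p v) (k : ℕ) :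
    0 ≤ distinctWeight p k :=
  Finset.sum_nonneg fun s _ => Finset.prod_nonneg fun i _ => hp (s i)

lemma distinctWeightThrough_mono {p : V → ℝ} (hp : ∀ v, 0 ≤ p v) (k : ℕ) {u v : V}
    (huv : p v ≤ p u) : distinctWeightThrough p k v ≤ distinctWeightThrough p k u := by
  unfold distinctWeightThrough
  calc _ ≤ ∑ s : Fin k → V with Function.Injective s ∧ v ∈ Set.range s,
        ∏ i, p (Equiv.swap u v (s i)) := by
        refine Finset.sum_le_sum fun s hs => ?_
        simp only [Finset.mem_filter, Finset.mem_univ, true_and] at hs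
        exact prod_le_prod_swap hp hs.1 huv hs.2
    _ = _ := by
        refine Finset.sum_equiv ((Equiv.refl (Fin k)).arrowCongr (Equiv.swap u v)) ?_ ?_
        · intro s
          simp only [Finset.mem_filter, Finset.mem_univ, true_and, Set.mem_range,
            Equiv.arrowCongr_apply, Equiv.refl_symm, Equiv.coe_refl, Function.comp_apply, id]
          refine and_congr ?_ ?_
          · exact ((Equiv.swap u v).injective.of_comp_iff s).symm
          · refine exists_congr fun i => ?_
            rw [Equiv.swap_apply_eq_iff, Equiv.swap_apply_left]
        · intro s _
          simp

lemma sum_ite_mem_range_eq {k : ℕ} {s : Fin k → V} (hs : Function.Injective s) (g : V → ℝ) :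
    ∑ v, (if v ∈ Set.range s then g v else 0) = ∑ i, g (s i) := by
  rw [← Finset.sum_filter, ← Finset.sum_image (f := g) (s := Finset.univ) (g := s) hs.injOn]
  refine Finset.sum_congr ?_ fun _ _ => rfl
  ext v
  simp

lemma sum_mul_distinctWeightThrough (p g : V → ℝ) (k : ℕ) :
    ∑ v, g v * distinctWeightThrough p k v =
      ∑ s : Fin k → V with Function.Injective s, (∑ i, g (s i)) * ∏ i, p (s i) := by
  unfold distinctWeightThrough
  simp_rw [← Finset.filter_filter, Finset.sum_filter _ (fun s : Fin k → V => ∏ i, p (s i)),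
    Finset.mul_sum]
  rw [Finset.sum_comm]
  refine Finset.sum_congr rfl fun s hs => ?_
  rw [← sum_ite_mem_range_eq (Finset.mem_filter.1 hs).2, Finset.sum_mul]
  refine Finset.sum_congr rfl fun v _ => ?_
  split_ifs <;> simp

lemma distinctWeight_succ {p : V → ℝ} (hp1 : ∑ v, p v = 1) (k : ℕ) :
    distinctWeight p (k + 1) =
      distinctWeight p k - ∑ v, p v * distinctWeightThrough p k v := by
  rw [sum_mul_distinctWeightThrough]
  unfold distinctWeight
  rw [← Finset.sum_sub_distrib, Finset.sum_filter,
    ← (Fin.consEquiv fun _ : Fin (k + 1) => V).sum_comp, Fintype.sum_prod_type_right,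
    Finset.sum_filter]
  refine Finset.sum_congr rfl fun s _ => ?_
  simp only [Fin.consEquiv, Equiv.coe_fn_mk, Fin.cons_injective_iff, Fin.prod_univ_succ,
    Fin.cons_zero, Fin.cons_succ]
  split_ifs with hs
  · rw [← sum_ite_mem_range_eq hs p, Finset.sum_mul, eq_sub_iff_add_eq,
      ← Finset.sum_add_distrib]
    trans ∑ v, p v * ∏ i, p (s i)
    · refine Finset.sum_congr rfl fun v _ => ?_
      by_cases hv : v ∈ Set.range s <;> simp [hv, hs]
    · rw [← Finset.sum_mul, hp1, one_mul]
  · simp [hs]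

lemma distinctWeight_succ_le {p : V → ℝ} (hp : ∀ v, 0 ≤ p v) (hp1 : ∑ v, p v = 1) (k : ℕ) :
    distinctWeight p (k + 1) ≤ (1 - k / Fintype.card V) * distinctWeight p k := by
  have hV : 0 < (Fintype.card V : ℝ) := by
    rcases isEmpty_or_nonempty V with h | h
    · simp at hp1
    · exact_mod_cast Fintype.card_pos
  have hmono : Monovary p (distinctWeightThrough p k) := by
    intro v u h
    by_contra! hlt
    exact absurd (distinctWeightThrough_mono hp k hlt.le) (not_le.2 h)
  have hcheb := hmono.sum_mul_sum_le_card_mul_sum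
  have htotal : ∑ v, distinctWeightThrough p k v = k * distinctWeight p k := by
    have := sum_mul_distinctWeightThrough p (fun _ => 1) k
    simpa [distinctWeight, Finset.mul_sum] using this
  rw [hp1, one_mul, htotal] at hcheb
  rw [distinctWeight_succ hp1, sub_mul, one_mul, div_mul_eq_mul_div]
  refine sub_le_sub_left ?_ _
  rw [div_le_iff₀' hV]
  exact hcheb

lemma distinctWeight_succ_le_exp {p : V → ℝ} (hp : ∀ v, 0 ≤ p v) (hp1 : ∑ v, p v = 1) (k : ℕ) :
    distinctWeight p (k + 1) ≤ Real.exp (-(1 / (2 * Fintype.card V)) * (k : ℝ) ^ 2) := by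
  induction k with
  | zero =>
    refine (distinctWeight_succ_le hp hp1 0).trans ?_
    simp [distinctWeight, Function.injective_of_subsingleton]
  | succ k ih =>
    have hstep : 1 - ((k + 1 : ℕ) : ℝ) / Fintype.card V
        ≤ Real.exp (-(((k + 1 : ℕ) : ℝ) / Fintype.card V)) := by
      have := Real.add_one_le_exp (-(((k + 1 : ℕ) : ℝ) / Fintype.card V))
      linarith
    refine (distinctWeight_succ_le hp hp1 (k + 1)).trans <|
      (mul_le_mul hstep ih (distinctWeight_nonneg hp _) (Real.exp_pos _).le).trans ?_
    rw [← Real.exp_add, Real.exp_le_exp]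
    have hc : 0 ≤ 1 / (2 * (Fintype.card V : ℝ)) := by positivity
    have hd : ((k + 1 : ℕ) : ℝ) / Fintype.card V
        = 2 * (k + 1) * (1 / (2 * (Fintype.card V : ℝ))) := by
      push_cast
      ring
    rw [hd]
    push_cast
    nlinarith

/-- A prescribed cycle occurs in the random function with probability the product of the weights
of its vertices. -/
lemma sum_prod_filter_cycle {p : V → ℝ} (hp1 : ∑ v, p v = 1) {k : ℕ} {s : Fin (k + 1) → V}
    (hs : Function.Injective s) :
    ∑ f : V → V with ∀ i, f (s i) = s (i + 1), ∏ v, p (f v) = ∏ i, p (s i) := by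
  have hpi : (Finset.univ.filter fun f : V → V => ∀ i, f (s i) = s (i + 1)) =
      Fintype.piFinset fun v => Finset.univ.filter fun w => ∀ i, s i = v → w = s (i + 1) := by
    ext f
    simp only [Finset.mem_filter, Finset.mem_univ, true_and, Fintype.mem_piFinset]
    exact ⟨fun h v i hi => hi ▸ h i, fun h i => h _ i rfl⟩
  rw [hpi, ← Finset.prod_univ_sum _ fun _ w => p w,
    ← Finset.prod_subset (Finset.subset_univ (Finset.univ.image s)), Finset.prod_image hs.injOn,
    ← Equiv.prod_comp (Equiv.addRight (1 : Fin (k + 1))) fun i => p (s i)]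
  · refine Finset.prod_congr rfl fun i _ => ?_
    rw [Equiv.coe_addRight, ← Finset.sum_singleton p (s (i + 1))]
    refine Finset.sum_congr ?_ fun _ _ => rfl
    ext w
    simp [hs.eq_iff]
  · intro v _ hv
    rw [← hp1]
    refine Finset.sum_congr (Finset.filter_true_of_mem fun w _ i hi => ?_) fun _ _ => rfl
    exact absurd (Finset.mem_image.2 ⟨i, Finset.mem_univ i, hi⟩) hv

lemma card_cyclic_le (f : V → V) :
    (Finset.univ.filter fun x : V => ∃ t : ℕ, 1 ≤ t ∧ f^[t] x = x).card ≤
      ∑ k ∈ Finset.range (Fintype.card V), (Finset.univ.filter fun s : Fin (k + 1) → V =>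
        Function.Injective s ∧ ∀ i, f (s i) = s (i + 1)).card := by
  refine (Finset.card_le_card (t := (Finset.range (Fintype.card V)).biUnion fun k =>
    (Finset.univ.filter fun s : Fin (k + 1) → V =>
      Function.Injective s ∧ ∀ i, f (s i) = s (i + 1)).image fun s => s 0) ?_).trans
    (Finset.card_biUnion_le.trans (Finset.sum_le_sum fun k _ => Finset.card_image_le))
  intro x hx
  obtain ⟨t, ht, hfx⟩ := (Finset.mem_filter.1 hx).2
  have hpos : 0 < Function.minimalPeriod f x :=
    Function.minimalPeriod_pos_of_mem_periodicPts ⟨t, ht, hfx⟩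
  obtain ⟨k, hk⟩ : ∃ k, Function.minimalPeriod f x = k + 1 :=
    ⟨_, (Nat.succ_pred_eq_of_pos hpos).symm⟩
  have hinj : Function.Injective fun i : Fin (k + 1) => f^[i] x := by
    intro i j hij
    exact Fin.ext (Function.iterate_injOn_Iio_minimalPeriod (f := f) (x := x)
      (i.isLt.trans_eq hk.symm) (j.isLt.trans_eq hk.symm) hij)
  have hcard := Fintype.card_le_of_injective _ hinj
  rw [Fintype.card_fin] at hcard
  refine Finset.mem_biUnion.2 ⟨k, Finset.mem_range.2 hcard, Finset.mem_image.2
    ⟨fun i => f^[i] x, ?_, by simp⟩⟩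
  refine Finset.mem_filter.2 ⟨Finset.mem_univ _, hinj, fun i => ?_⟩
  beta_reduce
  rw [← Function.iterate_succ_apply' f, Fin.val_add_one]
  split_ifs with hi
  · subst hi
    rw [Fin.val_last, Nat.succ_eq_add_one, ← hk, Function.iterate_minimalPeriod]
    rfl
  · rfl

lemma expected_card_cyclic_le_sum_distinctWeight {p : V → ℝ} (hp : ∀ v, 0 ≤ p v)
    (hp1 : ∑ v, p v = 1) :
    ∑ f : V → V, (∏ v, p (f v)) *
        ((Finset.univ.filter fun x : V => ∃ t : ℕ, 1 ≤ t ∧ f^[t] x = x).card : ℝ) ≤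
      ∑ k ∈ Finset.range (Fintype.card V), distinctWeight p (k + 1) := by
  calc _ ≤ ∑ f : V → V, (∏ v, p (f v)) * ∑ k ∈ Finset.range (Fintype.card V),
        ((Finset.univ.filter fun s : Fin (k + 1) → V =>
          Function.Injective s ∧ ∀ i, f (s i) = s (i + 1)).card : ℝ) := by
        refine Finset.sum_le_sum fun f _ => mul_le_mul_of_nonneg_left ?_
          (Finset.prod_nonneg fun v _ => hp _)
        exact_mod_cast card_cyclic_le f
    _ = _ := by
        simp_rw [Finset.mul_sum]
        rw [Finset.sum_comm]
        refine Finset.sum_congr rfl fun k _ => ?_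
        simp_rw [← Finset.filter_filter, Finset.card_filter, Nat.cast_sum, Finset.mul_sum]
        rw [Finset.sum_comm]
        refine Finset.sum_congr rfl fun s hs => ?_
        rw [← sum_prod_filter_cycle hp1 (Finset.mem_filter.1 hs).2, Finset.sum_filter]
        refine Finset.sum_congr rfl fun f _ => ?_
        split_ifs <;> simp

end DistinctSamples

lemma sum_range_exp_neg_mul_sq_le {b : ℝ} (hb : 0 < b) (n : ℕ) :
    ∑ k ∈ Finset.range n, Real.exp (-b * (k : ℝ) ^ 2) ≤ 1 + Real.sqrt (Real.pi / b) / 2 := by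
  have hanti : AntitoneOn (fun x : ℝ => Real.exp (-b * x ^ 2)) (Set.Icc 0 (0 + (n : ℕ))) := by
    intro x hx y _ hxy
    refine Real.exp_le_exp.2 ?_
    have := pow_le_pow_left₀ hx.1 hxy 2
    nlinarith
  have hintegral : ∫ x in (0 : ℝ)..(0 + (n : ℕ)), Real.exp (-b * x ^ 2) ≤
      Real.sqrt (Real.pi / b) / 2 := by
    rw [← integral_gaussian_Ioi, intervalIntegral.integral_of_le (by simp)]
    exact MeasureTheory.setIntegral_mono_set (integrable_exp_neg_mul_sq hb).integrableOn
      (Filter.Eventually.of_forall fun x => (Real.exp_pos _).le)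
      (Filter.Eventually.of_forall fun x hx => hx.1)
  have hsum := hanti.sum_le_integral.trans hintegral
  calc _ ≤ ∑ k ∈ Finset.range (n + 1), Real.exp (-b * (k : ℝ) ^ 2) :=
        Finset.sum_le_sum_of_subset_of_nonneg (by simp) fun _ _ _ => (Real.exp_pos _).le
    _ ≤ _ := by
        rw [Finset.sum_range_succ']
        simp only [zero_add] at hsum
        simp only [Nat.cast_zero, ne_eq, OfNat.ofNat_ne_zero, not_false_eq_true, zero_pow,
          mul_zero, Real.exp_zero]
        linarith

/-- For a random function `f : Fin n → Fin n` with independent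
values, `f(v)` distributed according to an arbitrary probability vector
`(p_v)`, the expected number of cyclic vertices is at most `(1+o(1))·√(2πn)`,
uniformly over the choice of probability vector. -/
theorem expected_cyclic_le_inhom :
    ∃ ε : ℕ → ℝ, Filter.Tendsto ε Filter.atTop (nhds 0) ∧
      ∀ n : ℕ, 1 ≤ n → ∀ p : Fin n → ℝ, (∀ v, 0 ≤ p v) → (∑ v, p v) = 1 →
        ∑ f : Fin n → Fin n, (∏ v, p (f v)) *
            ((Finset.univ.filter (fun x : Fin n =>
                ∃ t : ℕ, 1 ≤ t ∧ f^[t] x = x)).card : ℝ)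
          ≤ (1 + ε n) * Real.sqrt (2 * Real.pi * n) := by
  refine ⟨fun _ => 0, tendsto_const_nhds, fun n hn p hp hp1 => ?_⟩
  have hn1 : (1 : ℝ) ≤ n := by exact_mod_cast hn
  have hsum : ∑ k ∈ Finset.range n, distinctWeight p (k + 1) ≤
      ∑ k ∈ Finset.range n, Real.exp (-(1 / (2 * n)) * (k : ℝ) ^ 2) :=
    Finset.sum_le_sum fun k _ => by simpa using distinctWeight_succ_le_exp hp hp1 k
  have hgauss := sum_range_exp_neg_mul_sq_le (b := 1 / (2 * n)) (by positivity) n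
  have hpi : Real.pi / (1 / (2 * n)) = 2 * Real.pi * n := by
    rw [div_div_eq_mul_div, div_one]
    ring
  have htwo : 2 ≤ Real.sqrt (2 * Real.pi * n) :=
    Real.le_sqrt_of_sq_le (by nlinarith [Real.pi_gt_three])
  have hcyc := expected_card_cyclic_le_sum_distinctWeight hp hp1
  rw [Fintype.card_fin] at hcyc
  rw [hpi] at hgauss
  beta_reduce
  rw [add_zero, one_mul]
  have hbound : ∑ k ∈ Finset.range n, distinctWeight p (k + 1) ≤ Real.sqrt (2 * Real.pi * n) := by
    linarith
  refine Eq.trans_le ?_ (hcyc.trans hbound)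
  congr!
end
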